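/- arXiv:2211.06830 — 12 statements merged into one kernel-verified Lean document; each statement's English description precedes it below -/
import Mathlib

section
/- Let (T_1, T_2, u_1, u_2) be a finite two-person constant-sum game and let f be a correlated equilibrium of it. Then for each player i there is a constant v_i such that Σ_{t_j} f(t_i,t_j) u_i(t_i,t_j) / f_i(t_i) = v_i for every t_i ∈ T_i with f_i(t_i) > 0; that is, a player's conditional expected payoff given any of his actions that is played with positive probability is the same for all such actions, and v_1 + v_2 = c. -/
open Finset

/-- In a constant-sum game, a player's expected payoff on the event that a given action is
recommended is the probability of that event times his overall expected payoff. -/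
lemma sum_mul_payoff_eq_marginal_mul_value {T₁ T₂ : Type*} [Fintype T₁] [Fintype T₂]
    {u₁ u₂ f : T₁ → T₂ → ℝ} {c : ℝ}
    (hconst : ∀ t₁ t₂, u₁ t₁ t₂ + u₂ t₁ t₂ = c)
    (hpos : ∀ t₁ t₂, 0 ≤ f t₁ t₂)
    (hsum : ∑ t₁, ∑ t₂, f t₁ t₂ = 1)
    (hce₁ : ∀ t₁ t₁', ∑ t₂, f t₁ t₂ * u₁ t₁' t₂ ≤ ∑ t₂, f t₁ t₂ * u₁ t₁ t₂)
    (hce₂ : ∀ t₂ t₂', ∑ t₁, f t₁ t₂ * u₂ t₁ t₂' ≤ ∑ t₁, f t₁ t₂ * u₂ t₁ t₂) (t₁ : T₁) :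
    ∑ t₂, f t₁ t₂ * u₁ t₁ t₂ = (∑ t₂, f t₁ t₂) * ∑ s₁, ∑ s₂, f s₁ s₂ * u₁ s₁ s₂ := by
  have hu₂ : ∀ s₁ s₂, u₂ s₁ s₂ = c - u₁ s₁ s₂ := fun s₁ s₂ => by linarith [hconst s₁ s₂]
  set V := ∑ s₁, ∑ s₂, f s₁ s₂ * u₁ s₁ s₂ with hV
  have column_ge (r : T₂) : V ≤ ∑ s₁, (∑ s₂, f s₁ s₂) * u₁ s₁ r := by
    have h : ∑ s₂, ∑ s₁, f s₁ s₂ * u₁ s₁ s₂ ≤ ∑ s₂, ∑ s₁, f s₁ s₂ * u₁ s₁ r := by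
      refine sum_le_sum fun s₂ _ => ?_
      have := hce₂ s₂ r
      simp only [hu₂, mul_sub, sum_sub_distrib] at this
      linarith
    rw [sum_comm, ← hV, sum_comm] at h
    simpa only [sum_mul] using h
  have row_ge (r : T₁) : (∑ s₂, f r s₂) * V ≤ ∑ s₂, f r s₂ * u₁ r s₂ :=
    calc (∑ s₂, f r s₂) * V
        ≤ ∑ s₂, f r s₂ * ∑ s₁, (∑ t₂, f s₁ t₂) * u₁ s₁ s₂ := by
          rw [sum_mul]
          exact sum_le_sum fun s₂ _ => mul_le_mul_of_nonneg_left (column_ge s₂) (hpos r s₂)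
      _ = ∑ s₁, (∑ t₂, f s₁ t₂) * ∑ s₂, f r s₂ * u₁ s₁ s₂ := by
          simp only [mul_sum]
          rw [sum_comm]
          exact sum_congr rfl fun _ _ => sum_congr rfl fun _ _ => by ring
      _ ≤ ∑ s₁, (∑ t₂, f s₁ t₂) * ∑ s₂, f r s₂ * u₁ r s₂ :=
          sum_le_sum fun s₁ _ =>
            mul_le_mul_of_nonneg_left (hce₁ r s₁) (sum_nonneg fun t₂ _ => hpos s₁ t₂)
      _ = ∑ s₂, f r s₂ * u₁ r s₂ := by rw [← sum_mul, hsum, one_mul]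
  have total : ∑ s₁, (∑ s₂, f s₁ s₂) * V = ∑ s₁, ∑ s₂, f s₁ s₂ * u₁ s₁ s₂ := by
    rw [← sum_mul, hsum, one_mul]
  exact ((sum_eq_sum_iff_of_le fun r _ => row_ge r).mp total t₁ (mem_univ t₁)).symm

/-- **Forges' observation.**  In a finite two-person constant-sum game, if `f` is a correlated
equilibrium, then each player's conditional expected payoff, given any of his own actions that is
played with positive probability, is the same constant `vᵢ` for all such actions, and
`v₁ + v₂ = c`. -/
theorem correlatedEquilibrium_constantSum_conditional_value
    (T₁ T₂ : Type) [Fintype T₁] [Fintype T₂] [Nonempty T₁] [Nonempty T₂]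
    (u₁ u₂ : T₁ → T₂ → ℝ) (c : ℝ)
    (hconst : ∀ t₁ : T₁, ∀ t₂ : T₂, u₁ t₁ t₂ + u₂ t₁ t₂ = c)
    (f : T₁ → T₂ → ℝ)
    (hpos : ∀ t₁ : T₁, ∀ t₂ : T₂, 0 ≤ f t₁ t₂)
    (hsum : ∑ t₁ : T₁, ∑ t₂ : T₂, f t₁ t₂ = 1)
    (hce₁ : ∀ t₁ t₁' : T₁, ∑ t₂ : T₂, f t₁ t₂ * u₁ t₁' t₂ ≤ ∑ t₂ : T₂, f t₁ t₂ * u₁ t₁ t₂)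
    (hce₂ : ∀ t₂ t₂' : T₂, ∑ t₁ : T₁, f t₁ t₂ * u₂ t₁ t₂' ≤ ∑ t₁ : T₁, f t₁ t₂ * u₂ t₁ t₂) :
    ∃ v₁ v₂ : ℝ, v₁ + v₂ = c ∧
      (∀ t₁ : T₁, 0 < ∑ t₂ : T₂, f t₁ t₂ →
        (∑ t₂ : T₂, f t₁ t₂ * u₁ t₁ t₂) / (∑ t₂ : T₂, f t₁ t₂) = v₁) ∧
      (∀ t₂ : T₂, 0 < ∑ t₁ : T₁, f t₁ t₂ →
        (∑ t₁ : T₁, f t₁ t₂ * u₂ t₁ t₂) / (∑ t₁ : T₁, f t₁ t₂) = v₂) := by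
  refine ⟨∑ s₁, ∑ s₂, f s₁ s₂ * u₁ s₁ s₂, ∑ s₂, ∑ s₁, f s₁ s₂ * u₂ s₁ s₂, ?_, ?_, ?_⟩
  · rw [sum_comm (γ := T₂)]
    simp only [← sum_add_distrib, ← mul_add, hconst, ← sum_mul, hsum, one_mul]
  · intro t₁ ht₁
    rw [div_eq_iff ht₁.ne', mul_comm]
    exact sum_mul_payoff_eq_marginal_mul_value hconst hpos hsum hce₁ hce₂ t₁
  · intro t₂ ht₂
    rw [div_eq_iff ht₂.ne', mul_comm]
    exact sum_mul_payoff_eq_marginal_mul_value (u₁ := fun s₂ s₁ => u₂ s₁ s₂)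
      (u₂ := fun s₂ s₁ => u₁ s₁ s₂) (f := fun s₂ s₁ => f s₁ s₂)
      (fun s₂ s₁ => by rw [add_comm, hconst]) (fun s₂ s₁ => hpos s₁ s₂)
      (by rw [sum_comm, hsum]) hce₂ hce₁ t₂
end

section
/- Assume u_1^k + u_2^k ≤ 1 for all k ∈ {1,…,n} and t_1 + t_2 < 1 for all (t_1,t_2) ∈ T (linear Pareto frontier with inefficient disagreement). If μ is an incentive compatible, individually rational and efficient mechanism, then μ is ex-ante incentive efficient: there is no incentive compatible, individually rational mechanism ν such that Σ_{t_i ∈ T_i} f_i(t_i) U_i^ν(t_i) ≥ Σ_{t_i ∈ T_i} f_i(t_i) U_i^μ(t_i) for both i = 1,2 with strict inequality for at least one i. -/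
open Finset

noncomputable section

/-- Ex-post expected utility of player 1 when `that` is the reported type pair and `t` is the
true type pair.  Index `0` of the mechanism is the disagreement outcome `a₀` (at which player 1
of type `t₁` gets utility `t₁`), and index `k.succ` is the alternative `aₖ`. -/
def u1post {n : ℕ} (u₁ : Fin n → ℝ) (μ : ℝ × ℝ → Fin (n + 1) → ℝ) (that t : ℝ × ℝ) : ℝ :=
  (∑ k : Fin n, μ that k.succ * u₁ k) + μ that 0 * t.1

/-- Ex-post expected utility of player 2. -/
def u2post {n : ℕ} (u₂ : Fin n → ℝ) (μ : ℝ × ℝ → Fin (n + 1) → ℝ) (that t : ℝ × ℝ) : ℝ :=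
  (∑ k : Fin n, μ that k.succ * u₂ k) + μ that 0 * t.2

/-- Marginal of the prior for player 1: `f₁(t₁) = ∑_{t₂ ∈ T₂} f(t₁,t₂)`. -/
def marg1 (T₂ : Finset ℝ) (f : ℝ × ℝ → ℝ) (t₁ : ℝ) : ℝ := ∑ t₂ ∈ T₂, f (t₁, t₂)

/-- Marginal of the prior for player 2: `f₂(t₂) = ∑_{t₁ ∈ T₁} f(t₁,t₂)`. -/
def marg2 (T₁ : Finset ℝ) (f : ℝ × ℝ → ℝ) (t₂ : ℝ) : ℝ := ∑ t₁ ∈ T₁, f (t₁, t₂)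

/-- Interim expected utility of player 1 of true type `t₁` reporting `r₁`, when player 2 reports
truthfully:  `U₁^μ(r₁|t₁) = ∑_{t₂} f₁^c(t₂|t₁) u₁^μ((r₁,t₂);(t₁,t₂))`. -/
def interim1 (T₂ : Finset ℝ) (f : ℝ × ℝ → ℝ) {n : ℕ} (u₁ : Fin n → ℝ)
    (μ : ℝ × ℝ → Fin (n + 1) → ℝ) (r₁ t₁ : ℝ) : ℝ :=
  ∑ t₂ ∈ T₂, f (t₁, t₂) / marg1 T₂ f t₁ * u1post u₁ μ (r₁, t₂) (t₁, t₂)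

/-- Interim expected utility of player 2 of true type `t₂` reporting `r₂`. -/
def interim2 (T₁ : Finset ℝ) (f : ℝ × ℝ → ℝ) {n : ℕ} (u₂ : Fin n → ℝ)
    (μ : ℝ × ℝ → Fin (n + 1) → ℝ) (r₂ t₂ : ℝ) : ℝ :=
  ∑ t₁ ∈ T₁, f (t₁, t₂) / marg2 T₁ f t₂ * u2post u₂ μ (t₁, r₂) (t₁, t₂)

/-- `f` is a (common prior) probability distribution on `T₁ × T₂` with positive marginals. -/
def IsPrior (T₁ T₂ : Finset ℝ) (f : ℝ × ℝ → ℝ) : Prop :=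
  (∀ t₁ ∈ T₁, ∀ t₂ ∈ T₂, 0 ≤ f (t₁, t₂)) ∧
  (∑ t₁ ∈ T₁, ∑ t₂ ∈ T₂, f (t₁, t₂)) = 1 ∧
  (∀ t₁ ∈ T₁, 0 < marg1 T₂ f t₁) ∧ (∀ t₂ ∈ T₂, 0 < marg2 T₁ f t₂)

/-- Physical feasibility: `μ t` is a probability vector over the `n + 1` alternatives. -/
def Feasible (T₁ T₂ : Finset ℝ) {n : ℕ} (μ : ℝ × ℝ → Fin (n + 1) → ℝ) : Prop :=
  ∀ t₁ ∈ T₁, ∀ t₂ ∈ T₂, (∀ k, 0 ≤ μ (t₁, t₂) k) ∧ (∑ k, μ (t₁, t₂) k) = 1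

/-- Incentive compatibility: truthful reporting is a Bayesian Nash equilibrium. -/
def IC (T₁ T₂ : Finset ℝ) (f : ℝ × ℝ → ℝ) {n : ℕ} (u₁ u₂ : Fin n → ℝ)
    (μ : ℝ × ℝ → Fin (n + 1) → ℝ) : Prop :=
  (∀ t₁ ∈ T₁, ∀ r₁ ∈ T₁, interim1 T₂ f u₁ μ r₁ t₁ ≤ interim1 T₂ f u₁ μ t₁ t₁) ∧
  (∀ t₂ ∈ T₂, ∀ r₂ ∈ T₂, interim2 T₁ f u₂ μ r₂ t₂ ≤ interim2 T₁ f u₂ μ t₂ t₂)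

/-- Individual rationality: each type gets at least its disagreement value at the interim stage. -/
def IR (T₁ T₂ : Finset ℝ) (f : ℝ × ℝ → ℝ) {n : ℕ} (u₁ u₂ : Fin n → ℝ)
    (μ : ℝ × ℝ → Fin (n + 1) → ℝ) : Prop :=
  (∀ t₁ ∈ T₁, t₁ ≤ interim1 T₂ f u₁ μ t₁ t₁) ∧
  (∀ t₂ ∈ T₂, t₂ ≤ interim2 T₁ f u₂ μ t₂ t₂)

/-- Ordinality: each player's interim utility map is constant on his type set. -/
def OrdinalMech (T₁ T₂ : Finset ℝ) (f : ℝ × ℝ → ℝ) {n : ℕ} (u₁ u₂ : Fin n → ℝ)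
    (μ : ℝ × ℝ → Fin (n + 1) → ℝ) : Prop :=
  ∃ v₁ v₂ : ℝ, (∀ t₁ ∈ T₁, interim1 T₂ f u₁ μ t₁ t₁ = v₁) ∧
    (∀ t₂ ∈ T₂, interim2 T₁ f u₂ μ t₂ t₂ = v₂)

/-- The set `V` of feasible agreement utility pairs: expected utilities of lotteries over
`a₁, …, aₙ`. -/
def Vset {n : ℕ} (u₁ u₂ : Fin n → ℝ) : Set (ℝ × ℝ) :=
  {v | ∃ ℓ : Fin n → ℝ, (∀ k, 0 ≤ ℓ k) ∧ (∑ k, ℓ k) = 1 ∧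
    v = (∑ k, ℓ k * u₁ k, ∑ k, ℓ k * u₂ k)}

/-- The Pareto frontier `∂V` of `Vset`. -/
def paretoV {n : ℕ} (u₁ u₂ : Fin n → ℝ) : Set (ℝ × ℝ) :=
  {v ∈ Vset u₁ u₂ | ¬ ∃ v' ∈ Vset u₁ u₂, v.1 ≤ v'.1 ∧ v.2 ≤ v'.2 ∧ v' ≠ v}

theorem sum_marg1_mul_interim1 {T₁ T₂ : Finset ℝ} {f : ℝ × ℝ → ℝ}
    (hpos : ∀ t₁ ∈ T₁, 0 < marg1 T₂ f t₁) {n : ℕ} (u₁ : Fin n → ℝ)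
    (μ : ℝ × ℝ → Fin (n + 1) → ℝ) :
    ∑ t₁ ∈ T₁, marg1 T₂ f t₁ * interim1 T₂ f u₁ μ t₁ t₁ =
      ∑ t₁ ∈ T₁, ∑ t₂ ∈ T₂, f (t₁, t₂) * u1post u₁ μ (t₁, t₂) (t₁, t₂) := by
  refine Finset.sum_congr rfl fun t₁ h₁ => ?_
  rw [interim1, Finset.mul_sum]
  refine Finset.sum_congr rfl fun t₂ _ => ?_
  rw [← mul_assoc, mul_div_cancel₀ _ (hpos t₁ h₁).ne']

theorem sum_marg2_mul_interim2 {T₁ T₂ : Finset ℝ} {f : ℝ × ℝ → ℝ}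
    (hpos : ∀ t₂ ∈ T₂, 0 < marg2 T₁ f t₂) {n : ℕ} (u₂ : Fin n → ℝ)
    (μ : ℝ × ℝ → Fin (n + 1) → ℝ) :
    ∑ t₂ ∈ T₂, marg2 T₁ f t₂ * interim2 T₁ f u₂ μ t₂ t₂ =
      ∑ t₁ ∈ T₁, ∑ t₂ ∈ T₂, f (t₁, t₂) * u2post u₂ μ (t₁, t₂) (t₁, t₂) := by
  rw [Finset.sum_comm]
  refine Finset.sum_congr rfl fun t₂ h₂ => ?_
  rw [interim2, Finset.mul_sum]
  refine Finset.sum_congr rfl fun t₁ _ => ?_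
  rw [← mul_assoc, mul_div_cancel₀ _ (hpos t₂ h₂).ne']

/-- The sum of the players' ex-ante utilities is the expected ex-post total utility. -/
theorem exAnte_add_exAnte {T₁ T₂ : Finset ℝ} {f : ℝ × ℝ → ℝ} (hf : IsPrior T₁ T₂ f) {n : ℕ}
    (u₁ u₂ : Fin n → ℝ) (μ : ℝ × ℝ → Fin (n + 1) → ℝ) :
    ∑ t₁ ∈ T₁, marg1 T₂ f t₁ * interim1 T₂ f u₁ μ t₁ t₁ +
        ∑ t₂ ∈ T₂, marg2 T₁ f t₂ * interim2 T₁ f u₂ μ t₂ t₂ =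
      ∑ t₁ ∈ T₁, ∑ t₂ ∈ T₂, f (t₁, t₂) *
        (u1post u₁ μ (t₁, t₂) (t₁, t₂) + u2post u₂ μ (t₁, t₂) (t₁, t₂)) := by
  rw [sum_marg1_mul_interim1 hf.2.2.1, sum_marg2_mul_interim2 hf.2.2.2]
  simp only [mul_add, Finset.sum_add_distrib]

theorem u1post_add_u2post_le_one {n : ℕ} {u₁ u₂ : Fin n → ℝ} (hlin : ∀ k, u₁ k + u₂ k ≤ 1)
    {μ : ℝ × ℝ → Fin (n + 1) → ℝ} {that t : ℝ × ℝ} (ht : t.1 + t.2 ≤ 1)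
    (hnonneg : ∀ k, 0 ≤ μ that k) (hsum : ∑ k, μ that k = 1) :
    u1post u₁ μ that t + u2post u₂ μ that t ≤ 1 := by
  have hagree : ∑ k : Fin n, μ that k.succ * (u₁ k + u₂ k) ≤ ∑ k : Fin n, μ that k.succ :=
    Finset.sum_le_sum fun k _ => mul_le_of_le_one_right (hnonneg _) (hlin k)
  have hdisagree : μ that 0 * (t.1 + t.2) ≤ μ that 0 := mul_le_of_le_one_right (hnonneg _) ht
  rw [Fin.sum_univ_succ] at hsum
  simp only [mul_add, Finset.sum_add_distrib] at hagree hdisagree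
  unfold u1post u2post
  linarith

/-- **Proposition 1(1).**  With a linear Pareto frontier (`u₁ᵏ + u₂ᵏ ≤ 1` for all agreement
alternatives, and `t₁ + t₂ < 1` for all type pairs), every incentive compatible, individually
rational and efficient mechanism is ex-ante incentive efficient. -/
theorem efficient_implies_exAnte_incentive_efficient (n : ℕ) (hn : 2 ≤ n)
    (T₁ T₂ : Finset ℝ) (hT₁ : T₁.Nonempty) (hT₂ : T₂.Nonempty)
    (u₁ u₂ : Fin n → ℝ)
    (hnorm : u₁ ⟨0, by omega⟩ = 1 ∧ u₂ ⟨0, by omega⟩ = 0 ∧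
      u₁ ⟨1, by omega⟩ = 0 ∧ u₂ ⟨1, by omega⟩ = 1)
    (hlin : ∀ k : Fin n, u₁ k + u₂ k ≤ 1)
    (hdis : ∀ t₁ ∈ T₁, ∀ t₂ ∈ T₂, t₁ + t₂ < 1)
    (f : ℝ × ℝ → ℝ) (hf : IsPrior T₁ T₂ f)
    (μ : ℝ × ℝ → Fin (n + 1) → ℝ)
    (hfeas : Feasible T₁ T₂ μ) (hIC : IC T₁ T₂ f u₁ u₂ μ) (hIR : IR T₁ T₂ f u₁ u₂ μ)
    (heff : ∀ t₁ ∈ T₁, ∀ t₂ ∈ T₂, 0 < f (t₁, t₂) →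
      u1post u₁ μ (t₁, t₂) (t₁, t₂) + u2post u₂ μ (t₁, t₂) (t₁, t₂) = 1) :
    ¬ ∃ ν : ℝ × ℝ → Fin (n + 1) → ℝ,
      Feasible T₁ T₂ ν ∧ IC T₁ T₂ f u₁ u₂ ν ∧ IR T₁ T₂ f u₁ u₂ ν ∧
      (∑ t₁ ∈ T₁, marg1 T₂ f t₁ * interim1 T₂ f u₁ μ t₁ t₁ ≤
        ∑ t₁ ∈ T₁, marg1 T₂ f t₁ * interim1 T₂ f u₁ ν t₁ t₁) ∧
      (∑ t₂ ∈ T₂, marg2 T₁ f t₂ * interim2 T₁ f u₂ μ t₂ t₂ ≤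
        ∑ t₂ ∈ T₂, marg2 T₁ f t₂ * interim2 T₁ f u₂ ν t₂ t₂) ∧
      ((∑ t₁ ∈ T₁, marg1 T₂ f t₁ * interim1 T₂ f u₁ μ t₁ t₁ <
        ∑ t₁ ∈ T₁, marg1 T₂ f t₁ * interim1 T₂ f u₁ ν t₁ t₁) ∨
       (∑ t₂ ∈ T₂, marg2 T₁ f t₂ * interim2 T₁ f u₂ μ t₂ t₂ <
        ∑ t₂ ∈ T₂, marg2 T₁ f t₂ * interim2 T₁ f u₂ ν t₂ t₂)) := by
  rintro ⟨ν, hfeasν, -, -, h₁, h₂, hlt⟩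
  have hμ : ∑ t₁ ∈ T₁, marg1 T₂ f t₁ * interim1 T₂ f u₁ μ t₁ t₁ +
      ∑ t₂ ∈ T₂, marg2 T₁ f t₂ * interim2 T₁ f u₂ μ t₂ t₂ = 1 := by
    rw [exAnte_add_exAnte hf, ← hf.2.1]
    refine Finset.sum_congr rfl fun t₁ ht₁ => Finset.sum_congr rfl fun t₂ ht₂ => ?_
    rcases (hf.1 t₁ ht₁ t₂ ht₂).eq_or_lt with h | h
    · rw [← h, zero_mul]
    · rw [heff t₁ ht₁ t₂ ht₂ h, mul_one]
  have hν : ∑ t₁ ∈ T₁, marg1 T₂ f t₁ * interim1 T₂ f u₁ ν t₁ t₁ +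
      ∑ t₂ ∈ T₂, marg2 T₁ f t₂ * interim2 T₁ f u₂ ν t₂ t₂ ≤ 1 := by
    rw [exAnte_add_exAnte hf, ← hf.2.1]
    refine Finset.sum_le_sum fun t₁ ht₁ => Finset.sum_le_sum fun t₂ ht₂ => ?_
    obtain ⟨hnonneg, hsum⟩ := hfeasν t₁ ht₁ t₂ ht₂
    exact mul_le_of_le_one_right (hf.1 t₁ ht₁ t₂ ht₂)
      (u1post_add_u2post_le_one hlin (hdis t₁ ht₁ t₂ ht₂).le hnonneg hsum)
  rcases hlt with hlt | hlt <;> linarith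
end
end

section
/- In the pure-conflict case A = {a_0, a_1, a_2}, assume t_1 + t_2 < 1 for all (t_1,t_2) ∈ T and let μ be an incentive compatible efficient mechanism (u_1^μ(t) + u_2^μ(t) = 1 for all t with f(t) > 0). Define the interim allocation μ_i^k(t_i) = Σ_{t_j} f_i^c(t_j|t_i) μ^k(t_i,t_j) (arguments in the appropriate coordinates), and call μ responsive if for some player i the map t_i ↦ (μ_i^0(t_i), μ_i^1(t_i), μ_i^2(t_i)) is not constant on T_i. Then μ is responsive if and only if μ is cardinal (i.e., some t_i ↦ U_i^μ(t_i) is not constant). -/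
open Finset

noncomputable section

/-- The average of a map into the standard 2-simplex whose `0`-th coordinate vanishes on the
support of the weights is determined by its coordinate `1`. -/
theorem sum_mul_simplex_eq {S : Finset ℝ} {w : ℝ → ℝ} {p : ℝ → Fin 3 → ℝ}
    (hw : ∑ x ∈ S, w x = 1) (hp : ∀ x ∈ S, ∑ k, p x k = 1)
    (h0 : ∀ x ∈ S, w x * p x 0 = 0) :
    ∑ x ∈ S, w x * p x 0 = 0 ∧ ∑ x ∈ S, w x * p x 2 = 1 - ∑ x ∈ S, w x * p x 1 := by
  refine ⟨Finset.sum_eq_zero h0, ?_⟩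
  rw [← hw, ← Finset.sum_sub_distrib]
  refine Finset.sum_congr rfl fun x hx => ?_
  have h := hp x hx
  rw [Fin.sum_univ_three] at h
  linear_combination w x * h - h0 x hx

/-- **Proposition 2.**  In the pure-conflict case `A = {a₀, a₁, a₂}` with a linear Pareto
frontier, an incentive compatible efficient mechanism is responsive (its interim allocation
depends on some type) if and only if it is cardinal (some interim utility map is non-constant). -/
theorem responsive_iff_cardinal
    (T₁ T₂ : Finset ℝ) (hT₁ : T₁.Nonempty) (hT₂ : T₂.Nonempty)
    (u₁ u₂ : Fin 2 → ℝ)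
    (hnorm : u₁ 0 = 1 ∧ u₂ 0 = 0 ∧ u₁ 1 = 0 ∧ u₂ 1 = 1)
    (hdis : ∀ t₁ ∈ T₁, ∀ t₂ ∈ T₂, t₁ + t₂ < 1)
    (f : ℝ × ℝ → ℝ) (hf : IsPrior T₁ T₂ f)
    (μ : ℝ × ℝ → Fin 3 → ℝ)
    (hfeas : Feasible T₁ T₂ μ) (hIC : IC T₁ T₂ f u₁ u₂ μ)
    (heff : ∀ t₁ ∈ T₁, ∀ t₂ ∈ T₂, 0 < f (t₁, t₂) →
      u1post u₁ μ (t₁, t₂) (t₁, t₂) + u2post u₂ μ (t₁, t₂) (t₁, t₂) = 1) :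
    ((∃ t₁ ∈ T₁, ∃ s₁ ∈ T₁, ∃ k : Fin 3,
        (∑ t₂ ∈ T₂, f (t₁, t₂) / marg1 T₂ f t₁ * μ (t₁, t₂) k) ≠
        (∑ t₂ ∈ T₂, f (s₁, t₂) / marg1 T₂ f s₁ * μ (s₁, t₂) k)) ∨
     (∃ t₂ ∈ T₂, ∃ s₂ ∈ T₂, ∃ k : Fin 3,
        (∑ t₁ ∈ T₁, f (t₁, t₂) / marg2 T₁ f t₂ * μ (t₁, t₂) k) ≠
        (∑ t₁ ∈ T₁, f (t₁, s₂) / marg2 T₁ f s₂ * μ (t₁, s₂) k))) ↔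
    ¬ OrdinalMech T₁ T₂ f u₁ u₂ μ := by
  obtain ⟨h10, h20, h11, h21⟩ := hnorm
  obtain ⟨hpos, -, hm₁, hm₂⟩ := hf
  have hzero : ∀ t₁ ∈ T₁, ∀ t₂ ∈ T₂, f (t₁, t₂) * μ (t₁, t₂) 0 = 0 := by
    intro t₁ ht₁ t₂ ht₂
    rcases (hpos t₁ ht₁ t₂ ht₂).eq_or_lt with h | h
    · rw [← h, zero_mul]
    · have he := heff t₁ ht₁ t₂ ht₂ h
      have hs := (hfeas t₁ ht₁ t₂ ht₂).2
      simp only [u1post, u2post, Fin.sum_univ_two, h10, h20, h11, h21, Fin.succ_zero_eq_one,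
        Fin.succ_one_eq_two] at he
      rw [Fin.sum_univ_three] at hs
      have hprod : μ (t₁, t₂) 0 * (1 - t₁ - t₂) = 0 := by linear_combination hs - he
      rcases mul_eq_zero.mp hprod with h' | h'
      · rw [h', mul_zero]
      · linarith [hdis t₁ ht₁ t₂ ht₂]
  have hzero₁ : ∀ t₁ ∈ T₁, ∀ t₂ ∈ T₂,
      f (t₁, t₂) / marg1 T₂ f t₁ * μ (t₁, t₂) 0 = 0 := fun t₁ ht₁ t₂ ht₂ => by
    rw [div_mul_eq_mul_div, hzero t₁ ht₁ t₂ ht₂, zero_div]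
  have hzero₂ : ∀ t₂ ∈ T₂, ∀ t₁ ∈ T₁,
      f (t₁, t₂) / marg2 T₁ f t₂ * μ (t₁, t₂) 0 = 0 := fun t₂ ht₂ t₁ ht₁ => by
    rw [div_mul_eq_mul_div, hzero t₁ ht₁ t₂ ht₂, zero_div]
  have hU₁ : ∀ t₁ ∈ T₁, interim1 T₂ f u₁ μ t₁ t₁ =
      ∑ t₂ ∈ T₂, f (t₁, t₂) / marg1 T₂ f t₁ * μ (t₁, t₂) 1 := fun t₁ ht₁ => by
    refine Finset.sum_congr rfl fun t₂ ht₂ => ?_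
    simp only [u1post, Fin.sum_univ_two, h10, h11, Fin.succ_zero_eq_one]
    linear_combination t₁ * hzero₁ t₁ ht₁ t₂ ht₂
  have hU₂ : ∀ t₂ ∈ T₂, interim2 T₁ f u₂ μ t₂ t₂ =
      ∑ t₁ ∈ T₁, f (t₁, t₂) / marg2 T₁ f t₂ * μ (t₁, t₂) 2 := fun t₂ ht₂ => by
    refine Finset.sum_congr rfl fun t₁ ht₁ => ?_
    simp only [u2post, Fin.sum_univ_two, h20, h21, Fin.succ_one_eq_two]
    linear_combination t₂ * hzero₂ t₂ ht₂ t₁ ht₁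
  have hA₁ := fun t₁ ht₁ => sum_mul_simplex_eq
    (w := fun t₂ => f (t₁, t₂) / marg1 T₂ f t₁) (p := fun t₂ => μ (t₁, t₂))
    (by rw [← Finset.sum_div]; exact div_self (hm₁ t₁ ht₁).ne')
    (fun t₂ ht₂ => (hfeas t₁ ht₁ t₂ ht₂).2) (hzero₁ t₁ ht₁)
  have hA₂ := fun t₂ ht₂ => sum_mul_simplex_eq
    (w := fun t₁ => f (t₁, t₂) / marg2 T₁ f t₂) (p := fun t₁ => μ (t₁, t₂))
    (by rw [← Finset.sum_div]; exact div_self (hm₂ t₂ ht₂).ne')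
    (fun t₁ ht₁ => (hfeas t₁ ht₁ t₂ ht₂).2) (hzero₂ t₂ ht₂)
  rw [← not_iff_not, not_not]
  push Not
  constructor
  · rintro ⟨hc₁, hc₂⟩
    obtain ⟨r₁, hr₁⟩ := hT₁
    obtain ⟨r₂, hr₂⟩ := hT₂
    exact ⟨_, _, fun t₁ ht₁ => (hU₁ t₁ ht₁).trans (hc₁ t₁ ht₁ r₁ hr₁ 1),
      fun t₂ ht₂ => (hU₂ t₂ ht₂).trans (hc₂ t₂ ht₂ r₂ hr₂ 2)⟩
  · rintro ⟨v₁, v₂, hv₁, hv₂⟩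
    constructor
    · intro t₁ ht₁ s₁ hs₁ k
      have h : ∑ t₂ ∈ T₂, f (t₁, t₂) / marg1 T₂ f t₁ * μ (t₁, t₂) 1 =
          ∑ t₂ ∈ T₂, f (s₁, t₂) / marg1 T₂ f s₁ * μ (s₁, t₂) 1 := by
        rw [← hU₁ t₁ ht₁, ← hU₁ s₁ hs₁, hv₁ t₁ ht₁, hv₁ s₁ hs₁]
      have ht := hA₁ t₁ ht₁
      have hs := hA₁ s₁ hs₁
      match k with
      | 0 => exact ht.1.trans hs.1.symm
      | 1 => exact h
      | 2 => linarith [ht.2, hs.2]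
    · intro t₂ ht₂ s₂ hs₂ k
      have h : ∑ t₁ ∈ T₁, f (t₁, t₂) / marg2 T₁ f t₂ * μ (t₁, t₂) 2 =
          ∑ t₁ ∈ T₁, f (t₁, s₂) / marg2 T₁ f s₂ * μ (t₁, s₂) 2 := by
        rw [← hU₂ t₂ ht₂, ← hU₂ s₂ hs₂, hv₂ t₂ ht₂, hv₂ s₂ hs₂]
      have ht := hA₂ t₂ ht₂
      have hs := hA₂ s₂ hs₂
      match k with
      | 0 => exact ht.1.trans hs.1.symm
      | 1 => linarith [ht.2, hs.2]
      | 2 => exact h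
end
end

section
/- In the pure-conflict problem A = {a_0, a_1, a_2} with T_1 = T_2 = {0, 1/4} and uniform prior f(t) = 1/4 for all t ∈ T, there exists a mechanism μ that is incentive compatible, individually rational, strongly efficient (μ^0(t) = 0 and u_1^μ(t) + u_2^μ(t) = 1 for all t), ordinal (U_i^μ is constant, equal to 1/2, for each i), and non-constant (μ(t) ≠ μ(t') for some t, t' ∈ T). -/
open Finset

noncomputable section

/-- Type set `{0, 1/4}` for both players. -/
def T0 : Finset ℝ := {0, 1/4}

/-- The uniform prior assigning probability `1/4` to each of the four states. -/
def f0 : ℝ × ℝ → ℝ := fun _ => 1/4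

/-- Player 1's utilities on the agreement alternatives `a₁, a₂`. -/
def uA : Fin 2 → ℝ := ![1, 0]

/-- Player 2's utilities on the agreement alternatives `a₁, a₂`. -/
def uB : Fin 2 → ℝ := ![0, 1]

theorem sum_T0 (g : ℝ → ℝ) : ∑ t ∈ T0, g t = g 0 + g (1/4) := by
  unfold T0
  exact Finset.sum_pair (by norm_num)

theorem mem_T0 {t : ℝ} : t ∈ T0 ↔ t = 0 ∨ t = 1/4 := by
  simp [T0]

/-- The mechanism choosing `a₁` when the reports agree and `a₂` when they differ. -/
def matchingMech : ℝ × ℝ → Fin 3 → ℝ := fun t => if t.1 = t.2 then ![0, 1, 0] else ![0, 0, 1]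

theorem matchingMech_zero (t : ℝ × ℝ) : matchingMech t 0 = 0 := by
  unfold matchingMech
  split_ifs <;> rfl

theorem u1post_matchingMech (r t : ℝ × ℝ) :
    u1post uA matchingMech r t = if r.1 = r.2 then 1 else 0 := by
  unfold u1post matchingMech
  split_ifs <;> simp [Fin.sum_univ_two, uA]

theorem u2post_matchingMech (r t : ℝ × ℝ) :
    u2post uB matchingMech r t = if r.1 = r.2 then 0 else 1 := by
  unfold u2post matchingMech
  split_ifs <;> simp [Fin.sum_univ_two, uB]

theorem feasible_matchingMech (T₁ T₂ : Finset ℝ) : Feasible T₁ T₂ matchingMech := by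
  intro t₁ _ t₂ _
  unfold matchingMech
  split_ifs <;> exact ⟨fun k => by fin_cases k <;> simp, by simp [Fin.sum_univ_three]⟩

theorem interim1_matchingMech {r : ℝ} (hr : r ∈ T0) (t : ℝ) :
    interim1 T0 f0 uA matchingMech r t = 1/2 := by
  simp only [interim1, marg1, f0, sum_T0, u1post_matchingMech]
  rcases mem_T0.1 hr with rfl | rfl <;> norm_num

theorem interim2_matchingMech {r : ℝ} (hr : r ∈ T0) (t : ℝ) :
    interim2 T0 f0 uB matchingMech r t = 1/2 := by
  simp only [interim2, marg2, f0, sum_T0, u2post_matchingMech]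
  rcases mem_T0.1 hr with rfl | rfl <;> norm_num

theorem le_half_of_mem_T0 {t : ℝ} (ht : t ∈ T0) : t ≤ 1/2 := by
  rcases mem_T0.1 ht with rfl | rfl <;> norm_num

/-- **Proposition 2 (second part), explicit example.**  In the pure-conflict problem with
`T₁ = T₂ = {0, 1/4}` and the uniform prior, there is a mechanism that is incentive compatible,
individually rational, strongly efficient, ordinal with interim utilities `1/2` for every type,
and yet non-constant. -/
theorem exists_nonconstant_ordinal_efficient_mechanism :
    ∃ μ : ℝ × ℝ → Fin 3 → ℝ,
      Feasible T0 T0 μ ∧ IC T0 T0 f0 uA uB μ ∧ IR T0 T0 f0 uA uB μ ∧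
      (∀ t₁ ∈ T0, ∀ t₂ ∈ T0, μ (t₁, t₂) 0 = 0 ∧
        u1post uA μ (t₁, t₂) (t₁, t₂) + u2post uB μ (t₁, t₂) (t₁, t₂) = 1) ∧
      (∀ t₁ ∈ T0, interim1 T0 f0 uA μ t₁ t₁ = 1/2) ∧
      (∀ t₂ ∈ T0, interim2 T0 f0 uB μ t₂ t₂ = 1/2) ∧
      (∃ t₁ ∈ T0, ∃ t₂ ∈ T0, ∃ s₁ ∈ T0, ∃ s₂ ∈ T0, μ (t₁, t₂) ≠ μ (s₁, s₂)) := by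
  refine ⟨matchingMech, feasible_matchingMech T0 T0, ⟨?_, ?_⟩, ⟨?_, ?_⟩, ?_, ?_, ?_, ?_⟩
  · intro t ht r hr
    rw [interim1_matchingMech hr, interim1_matchingMech ht]
  · intro t ht r hr
    rw [interim2_matchingMech hr, interim2_matchingMech ht]
  · intro t ht
    rw [interim1_matchingMech ht]
    exact le_half_of_mem_T0 ht
  · intro t ht
    rw [interim2_matchingMech ht]
    exact le_half_of_mem_T0 ht
  · intro t₁ _ t₂ _
    refine ⟨matchingMech_zero _, ?_⟩
    rw [u1post_matchingMech, u2post_matchingMech]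
    split_ifs <;> norm_num
  · exact fun t ht => interim1_matchingMech ht t
  · exact fun t ht => interim2_matchingMech ht t
  · refine ⟨0, mem_T0.2 (.inl rfl), 0, mem_T0.2 (.inl rfl), 0, mem_T0.2 (.inl rfl),
      1/4, mem_T0.2 (.inr rfl), fun h => ?_⟩
    have h1 := congrFun h 1
    norm_num [matchingMech] at h1
end
end

section
/- In the transferable-utility bargaining problem, assume: v_1^1 ≥ v_1^k for all k (a_1 is player 1's best alternative), a_1 is the utilitarian optimum (v_1^1 + v_2^1 ≥ v_1^k + v_2^k for all k ∈ {1,…,n}), f has full support, and b_1 > (v_1^1 + b_2 − min T_1) / min_{t ∈ T} f_1^c(t_2|t_1). Then every incentive compatible, individually rational and efficient mechanism μ is ordinal: for each player i, U_i^μ(t_i) is the same for all t_i ∈ T_i. -/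
open Finset

noncomputable section

/-- The set `W` of expected utility pairs of (finitely supported) lotteries over agreement
allocations `(aₖ, m)`: alternative `aₖ` together with a split of the total money `M`
(`m` to player 1, `M - m` to player 2). -/
def Wset {n : ℕ} (v₁ v₂ : Fin n → ℝ) (M : ℝ) : Set (ℝ × ℝ) :=
  convexHull ℝ {p : ℝ × ℝ | ∃ k : Fin n, ∃ m : ℝ, 0 ≤ m ∧ m ≤ M ∧
    p = (v₁ k + m, v₂ k + (M - m))}

/-- The Pareto frontier `∂W` of `Wset`. -/
def paretoW {n : ℕ} (v₁ v₂ : Fin n → ℝ) (M : ℝ) : Set (ℝ × ℝ) :=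
  {w ∈ Wset v₁ v₂ M | ¬ ∃ w' ∈ Wset v₁ v₂ M, w.1 ≤ w'.1 ∧ w.2 ≤ w'.2 ∧ w' ≠ w}

/-- Ex-post expected utility of player 1 under a mechanism described by the disagreement
probability `μ0` and the conditional expected agreement utility pair `w`: with probability
`μ0 t̂` disagreement obtains (payoff `t₁ + b₁`), otherwise the agreement pair `w t̂`. -/
def tu1post (b₁ : ℝ) (μ0 : ℝ × ℝ → ℝ) (w : ℝ × ℝ → ℝ × ℝ) (that t : ℝ × ℝ) : ℝ :=
  μ0 that * (t.1 + b₁) + (1 - μ0 that) * (w that).1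

/-- Ex-post expected utility of player 2. -/
def tu2post (b₂ : ℝ) (μ0 : ℝ × ℝ → ℝ) (w : ℝ × ℝ → ℝ × ℝ) (that t : ℝ × ℝ) : ℝ :=
  μ0 that * (t.2 + b₂) + (1 - μ0 that) * (w that).2

/-- Interim expected utility of player 1 of true type `t₁` reporting `r₁`. -/
def tuInterim1 (T₂ : Finset ℝ) (f : ℝ × ℝ → ℝ) (b₁ : ℝ) (μ0 : ℝ × ℝ → ℝ)
    (w : ℝ × ℝ → ℝ × ℝ) (r₁ t₁ : ℝ) : ℝ :=
  ∑ t₂ ∈ T₂, f (t₁, t₂) / marg1 T₂ f t₁ * tu1post b₁ μ0 w (r₁, t₂) (t₁, t₂)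

/-- Interim expected utility of player 2 of true type `t₂` reporting `r₂`. -/
def tuInterim2 (T₁ : Finset ℝ) (f : ℝ × ℝ → ℝ) (b₂ : ℝ) (μ0 : ℝ × ℝ → ℝ)
    (w : ℝ × ℝ → ℝ × ℝ) (r₂ t₂ : ℝ) : ℝ :=
  ∑ t₁ ∈ T₁, f (t₁, t₂) / marg2 T₁ f t₂ * tu2post b₂ μ0 w (t₁, r₂) (t₁, t₂)

/-- In every agreement lottery, player 1 gets at most her best alternative plus all the money,
and total utility is at most the utilitarian optimum plus all the money. -/
lemma Wset_bounds {n : ℕ} {v₁ v₂ : Fin n → ℝ} {M A S : ℝ} (hA : ∀ k, v₁ k ≤ A)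
    (hS : ∀ k, v₁ k + v₂ k ≤ S) {p : ℝ × ℝ} (hp : p ∈ Wset v₁ v₂ M) :
    p.1 ≤ A + M ∧ p.1 + p.2 ≤ S + M := by
  have hconv : Convex ℝ {q : ℝ × ℝ | q.1 ≤ A + M ∧ q.1 + q.2 ≤ S + M} := by
    rintro x ⟨hx₁, hx₂⟩ y ⟨hy₁, hy₂⟩ a b ha hb hab
    simp only [Set.mem_ofPred_eq, Prod.fst_add, Prod.snd_add, Prod.smul_fst, Prod.smul_snd,
      smul_eq_mul]
    obtain rfl : b = 1 - a := by linarith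
    constructor <;> nlinarith
  refine convexHull_min ?_ hconv hp
  rintro _ ⟨k, m, hm₀, hmM, rfl⟩
  have := hA k
  have := hS k
  constructor <;> dsimp only <;> linarith

/-- A Pareto optimal point giving player 1 at least the value of the utilitarian optimum
`k₀` exhausts the maximal total utility. -/
lemma add_eq_of_mem_paretoW {n : ℕ} {v₁ v₂ : Fin n → ℝ} {M : ℝ} {k₀ : Fin n}
    (hbest : ∀ k, v₁ k ≤ v₁ k₀) (hutil : ∀ k, v₁ k + v₂ k ≤ v₁ k₀ + v₂ k₀) {p : ℝ × ℝ}
    (hp : p ∈ paretoW v₁ v₂ M) (hp₀ : v₁ k₀ ≤ p.1) : p.1 + p.2 = v₁ k₀ + v₂ k₀ + M := by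
  obtain ⟨h₁, h₂⟩ := Wset_bounds hbest hutil hp.1
  by_contra hne
  have hlt := lt_of_le_of_ne h₂ hne
  refine hp.2 ⟨(p.1, v₁ k₀ + v₂ k₀ + M - p.1), subset_convexHull ℝ _
    ⟨k₀, p.1 - v₁ k₀, by linarith, by linarith, ?_⟩, le_rfl, by dsimp only; linarith, ?_⟩
  · ext <;> dsimp only <;> ring
  · intro h
    have := congrArg Prod.snd h
    dsimp only at this
    linarith

/-- In a constant-sum game, every recommendation of positive probability in a correlated
equilibrium gives player 1 the same conditional payoff. -/
lemma constantSum_correlatedEquilibrium_payoff {α β : Type*} {S : Finset α} {T : Finset β}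
    {f g h : α → β → ℝ} {C : ℝ} (hf : ∀ s ∈ S, ∀ t ∈ T, 0 ≤ f s t)
    (hf₁ : ∑ s ∈ S, ∑ t ∈ T, f s t = 1) (hgh : ∀ s ∈ S, ∀ t ∈ T, g s t + h s t = C)
    (hg : ∀ s ∈ S, ∀ r ∈ S, ∑ t ∈ T, f s t * g r t ≤ ∑ t ∈ T, f s t * g s t)
    (hh : ∀ t ∈ T, ∀ r ∈ T, ∑ s ∈ S, f s t * h s r ≤ ∑ s ∈ S, f s t * h s t) :
    ∀ s ∈ S, ∑ t ∈ T, f s t * g s t =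
      (∑ t ∈ T, f s t) * ∑ s ∈ S, ∑ t ∈ T, f s t * g s t := by
  set E := ∑ s ∈ S, ∑ t ∈ T, f s t * g s t with hE
  have hh' : ∀ t ∈ T, ∀ r ∈ T, ∑ s ∈ S, f s t * g s t ≤ ∑ s ∈ S, f s t * g s r := by
    intro t ht r hr
    have key : ∀ q ∈ T, ∑ s ∈ S, f s t * h s q =
        (∑ s ∈ S, f s t) * C - ∑ s ∈ S, f s t * g s q := by
      intro q hq
      rw [sum_mul, ← sum_sub_distrib]
      refine sum_congr rfl fun s hs => ?_
      rw [← hgh s hs q hq]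
      ring
    have := hh t ht r hr
    rw [key t ht, key r hr] at this
    linarith
  have hcol : ∀ r ∈ T, E ≤ ∑ s ∈ S, (∑ t ∈ T, f s t) * g s r := by
    intro r hr
    calc E = ∑ t ∈ T, ∑ s ∈ S, f s t * g s t := sum_comm
      _ ≤ ∑ t ∈ T, ∑ s ∈ S, f s t * g s r := sum_le_sum fun t ht => hh' t ht r hr
      _ = ∑ s ∈ S, (∑ t ∈ T, f s t) * g s r := by
        rw [sum_comm]
        simp only [sum_mul]
  have hge : ∀ s ∈ S, 0 ≤ ∑ t ∈ T, f s t * g s t - (∑ t ∈ T, f s t) * E := by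
    intro s hs
    rw [sub_nonneg]
    calc (∑ t ∈ T, f s t) * E = ∑ t ∈ T, f s t * E := sum_mul ..
      _ ≤ ∑ t ∈ T, f s t * ∑ r ∈ S, (∑ u ∈ T, f r u) * g r t :=
        sum_le_sum fun t ht => mul_le_mul_of_nonneg_left (hcol t ht) (hf s hs t ht)
      _ = ∑ r ∈ S, (∑ u ∈ T, f r u) * ∑ t ∈ T, f s t * g r t := by
        simp only [mul_sum]
        rw [sum_comm]
        exact sum_congr rfl fun r _ => sum_congr rfl fun t _ => by ring
      _ ≤ ∑ r ∈ S, (∑ u ∈ T, f r u) * ∑ t ∈ T, f s t * g s t :=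
        sum_le_sum fun r hr =>
          mul_le_mul_of_nonneg_left (hg s hs r hr) (sum_nonneg (hf r hr))
      _ = ∑ t ∈ T, f s t * g s t := by rw [← sum_mul, hf₁, one_mul]
  have hsum : ∑ s ∈ S, (∑ t ∈ T, f s t * g s t - (∑ t ∈ T, f s t) * E) = 0 := by
    rw [sum_sub_distrib, ← sum_mul, hf₁, one_mul, sub_self]
  intro s hs
  exact sub_eq_zero.1 ((sum_eq_zero_iff_of_nonneg hge).1 hsum s hs)

/-- If a weighted average of numbers that are at most `B` is at least `L`, then an entry of
weight `p t` exceeds `B - b` as soon as `B - L < b * p t`. -/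
lemma sub_lt_of_le_weighted_sum {β : Type*} {T : Finset β} {p x : β → ℝ}
    {B L b : ℝ} (hp : ∀ t ∈ T, 0 ≤ p t) (hp₁ : ∑ t ∈ T, p t = 1) (hx : ∀ t ∈ T, x t ≤ B)
    (hL : L ≤ ∑ t ∈ T, p t * x t) {t : β} (ht : t ∈ T) (hb : B - L < b * p t) :
    B - b < x t := by
  have hone : p t * (B - x t) ≤ ∑ u ∈ T, p u * (B - x u) :=
    single_le_sum (f := fun u => p u * (B - x u))
      (fun u hu => mul_nonneg (hp u hu) (sub_nonneg.2 (hx u hu))) ht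
  have hsum : ∑ u ∈ T, p u * (B - x u) = B - ∑ u ∈ T, p u * x u := by
    simp only [mul_sub, sum_sub_distrib, ← sum_mul, hp₁, one_mul]
  by_contra! hle
  nlinarith [hp t ht]

/-- **Proposition 4.**  In the bargaining problem with transferable utility, if `a₁` is both
player 1's best alternative and the utilitarian optimum, `f` has full support, and player 1's
budget `b₁` is sufficiently large
(`b₁ > (v₁(a₁) + b₂ - min T₁) / min_{t} f₁ᶜ(t₂|t₁)`), then every incentive compatible,
individually rational and efficient mechanism is ordinal. -/
theorem transferableUtility_efficient_implies_ordinal (n : ℕ) (hn : 0 < n)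
    (T₁ T₂ : Finset ℝ) (hT₁ : T₁.Nonempty) (hT₂ : T₂.Nonempty)
    (v₁ v₂ : Fin n → ℝ) (b₁ b₂ : ℝ) (hb₁ : 0 ≤ b₁) (hb₂ : 0 ≤ b₂)
    (hbest : ∀ k : Fin n, v₁ k ≤ v₁ ⟨0, hn⟩)
    (hutil : ∀ k : Fin n, v₁ k + v₂ k ≤ v₁ ⟨0, hn⟩ + v₂ ⟨0, hn⟩)
    (f : ℝ × ℝ → ℝ) (hf : IsPrior T₁ T₂ f)
    (hfull : ∀ t₁ ∈ T₁, ∀ t₂ ∈ T₂, 0 < f (t₁, t₂))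
    (hbig : (v₁ ⟨0, hn⟩ + b₂ - T₁.min' hT₁) /
        ((T₁ ×ˢ T₂).inf' (hT₁.product hT₂) fun t => f t / marg1 T₂ f t.1) < b₁)
    (μ0 : ℝ × ℝ → ℝ) (w : ℝ × ℝ → ℝ × ℝ)
    (hfeas : ∀ t₁ ∈ T₁, ∀ t₂ ∈ T₂, 0 ≤ μ0 (t₁, t₂) ∧ μ0 (t₁, t₂) ≤ 1 ∧
      w (t₁, t₂) ∈ Wset v₁ v₂ (b₁ + b₂))
    (hIC₁ : ∀ t₁ ∈ T₁, ∀ r₁ ∈ T₁,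
      tuInterim1 T₂ f b₁ μ0 w r₁ t₁ ≤ tuInterim1 T₂ f b₁ μ0 w t₁ t₁)
    (hIC₂ : ∀ t₂ ∈ T₂, ∀ r₂ ∈ T₂,
      tuInterim2 T₁ f b₂ μ0 w r₂ t₂ ≤ tuInterim2 T₁ f b₂ μ0 w t₂ t₂)
    (hIR₁ : ∀ t₁ ∈ T₁, t₁ + b₁ ≤ tuInterim1 T₂ f b₁ μ0 w t₁ t₁)
    (hIR₂ : ∀ t₂ ∈ T₂, t₂ + b₂ ≤ tuInterim2 T₁ f b₂ μ0 w t₂ t₂)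
    (heff : ∀ t₁ ∈ T₁, ∀ t₂ ∈ T₂, 0 < f (t₁, t₂) → μ0 (t₁, t₂) = 0 ∧
      (tu1post b₁ μ0 w (t₁, t₂) (t₁, t₂), tu2post b₂ μ0 w (t₁, t₂) (t₁, t₂)) ∈
        paretoW v₁ v₂ (b₁ + b₂)) :
    ∃ V₁ V₂ : ℝ, (∀ t₁ ∈ T₁, tuInterim1 T₂ f b₁ μ0 w t₁ t₁ = V₁) ∧
      (∀ t₂ ∈ T₂, tuInterim2 T₁ f b₂ μ0 w t₂ t₂ = V₂) := by
  obtain ⟨hf0, hf1, hm1, hm2⟩ := hf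
  set k₀ : Fin n := ⟨0, hn⟩
  have hμ : ∀ t₁ ∈ T₁, ∀ t₂ ∈ T₂, μ0 (t₁, t₂) = 0 := fun t₁ h₁ t₂ h₂ =>
    (heff t₁ h₁ t₂ h₂ (hfull t₁ h₁ t₂ h₂)).1
  have hpar : ∀ t₁ ∈ T₁, ∀ t₂ ∈ T₂, w (t₁, t₂) ∈ paretoW v₁ v₂ (b₁ + b₂) := by
    intro t₁ h₁ t₂ h₂
    simpa [tu1post, tu2post, hμ t₁ h₁ t₂ h₂] using (heff t₁ h₁ t₂ h₂ (hfull t₁ h₁ t₂ h₂)).2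
  have hU₁ : ∀ r ∈ T₁, ∀ t ∈ T₁, tuInterim1 T₂ f b₁ μ0 w r t =
      ∑ t₂ ∈ T₂, f (t, t₂) / marg1 T₂ f t * (w (r, t₂)).1 := fun r hr t _ =>
    sum_congr rfl fun t₂ h₂ => by simp [tu1post, hμ r hr t₂ h₂]
  have hU₁' : ∀ r ∈ T₁, ∀ t ∈ T₁, tuInterim1 T₂ f b₁ μ0 w r t =
      (∑ t₂ ∈ T₂, f (t, t₂) * (w (r, t₂)).1) / marg1 T₂ f t := by
    intro r hr t ht
    rw [hU₁ r hr t ht, sum_div]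
    exact sum_congr rfl fun _ _ => by ring
  have hU₂ : ∀ r ∈ T₂, ∀ t ∈ T₂, tuInterim2 T₁ f b₂ μ0 w r t =
      (∑ t₁ ∈ T₁, f (t₁, t) * (w (t₁, r)).2) / marg2 T₁ f t := by
    intro r hr t _
    rw [sum_div]
    exact sum_congr rfl fun t₁ h₁ => by simp [tu2post, hμ t₁ h₁ r hr]; ring
  have hw₁ : ∀ t₁ ∈ T₁, ∀ t₂ ∈ T₂, v₁ k₀ ≤ (w (t₁, t₂)).1 := by
    intro t₁ h₁ t₂ h₂
    set q := (T₁ ×ˢ T₂).inf' (hT₁.product hT₂) fun t => f t / marg1 T₂ f t.1 with hq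
    have hq0 : 0 < q := by
      rw [hq, lt_inf'_iff]
      intro t ht
      rw [mem_product] at ht
      exact div_pos (hfull _ ht.1 _ ht.2) (hm1 _ ht.1)
    have hqp : q ≤ f (t₁, t₂) / marg1 T₂ f t₁ :=
      inf'_le (fun t : ℝ × ℝ => f t / marg1 T₂ f t.1) (mk_mem_product h₁ h₂)
    have hmin := T₁.min'_le t₁ h₁
    have hlt := (div_lt_iff₀ hq0).1 hbig
    have hmul := mul_le_mul_of_nonneg_left hqp hb₁
    have hIR := hIR₁ t₁ h₁
    rw [hU₁ t₁ h₁ t₁ h₁] at hIR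
    have := sub_lt_of_le_weighted_sum (B := v₁ k₀ + (b₁ + b₂)) (b := b₁)
      (fun t ht => (div_pos (hfull t₁ h₁ t ht) (hm1 t₁ h₁)).le)
      (by rw [← sum_div]; exact div_self (hm1 t₁ h₁).ne')
      (fun t ht => (Wset_bounds hbest hutil (hpar t₁ h₁ t ht).1).1) hIR h₂ (by linarith)
    linarith
  have hsum : ∀ t₁ ∈ T₁, ∀ t₂ ∈ T₂,
      (w (t₁, t₂)).1 + (w (t₁, t₂)).2 = v₁ k₀ + v₂ k₀ + (b₁ + b₂) := fun t₁ h₁ t₂ h₂ =>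
    add_eq_of_mem_paretoW hbest hutil (hpar t₁ h₁ t₂ h₂) (hw₁ t₁ h₁ t₂ h₂)
  have hg : ∀ s ∈ T₁, ∀ r ∈ T₁, ∑ t ∈ T₂, f (s, t) * (w (r, t)).1 ≤
      ∑ t ∈ T₂, f (s, t) * (w (s, t)).1 := by
    intro s hs r hr
    have := hIC₁ s hs r hr
    rwa [hU₁' r hr s hs, hU₁' s hs s hs, div_le_div_iff_of_pos_right (hm1 s hs)] at this
  have hh : ∀ t ∈ T₂, ∀ r ∈ T₂, ∑ s ∈ T₁, f (s, t) * (w (s, r)).2 ≤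
      ∑ s ∈ T₁, f (s, t) * (w (s, t)).2 := by
    intro t ht r hr
    have := hIC₂ t ht r hr
    rwa [hU₂ r hr t ht, hU₂ t ht t ht, div_le_div_iff_of_pos_right (hm2 t ht)] at this
  refine ⟨∑ s ∈ T₁, ∑ t ∈ T₂, f (s, t) * (w (s, t)).1,
    ∑ t ∈ T₂, ∑ s ∈ T₁, f (s, t) * (w (s, t)).2, fun s hs => ?_, fun t ht => ?_⟩
  · rw [hU₁' s hs s hs, div_eq_iff (hm1 s hs).ne', mul_comm]
    exact constantSum_correlatedEquilibrium_payoff (f := fun s t => f (s, t))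
      (g := fun s t => (w (s, t)).1) (h := fun s t => (w (s, t)).2) hf0 hf1 hsum hg hh s hs
  · rw [hU₂ t ht t ht, div_eq_iff (hm2 t ht).ne', mul_comm]
    exact constantSum_correlatedEquilibrium_payoff (f := fun t s => f (s, t))
      (g := fun t s => (w (s, t)).2) (h := fun t s => (w (s, t)).1)
      (fun t ht s hs => hf0 s hs t ht) (sum_comm.trans hf1)
      (fun t ht s hs => (add_comm _ _).trans (hsum s hs t ht)) hh hg t ht
end
end

section
/- Suppose f has full support and is independent, i.e., f(t_1,t_2) = f_1(t_1) f_2(t_2) for all t. If μ is an incentive compatible mechanism with μ^0(t) = 0 for all t ∈ T (as holds for any efficient mechanism, since a_0 is strictly Pareto dominated), then μ is ordinal: for each player i, U_i^μ(t_i) is the same for all t_i ∈ T_i. -/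
open Finset

noncomputable section

/-- If the conditional weights `p r x / m r = q x` do not depend on the type `r`, and the ex-post
payoff `g r t x` from reporting `r` does not depend on the true type `t`, then the interim payoff
from reporting `r` is the same for every true type. -/
theorem sum_div_mul_eq_of_weights_eq {α β : Type*} {S : Finset α} {T : Finset β} {p : α → β → ℝ}
    {m : α → ℝ} {q : β → ℝ} {g : α → α → β → ℝ} {h : α → β → ℝ}
    (hm : ∀ t ∈ S, 0 < m t) (hp : ∀ t ∈ S, ∀ x ∈ T, p t x = m t * q x)
    (hg : ∀ r ∈ S, ∀ t ∈ S, ∀ x ∈ T, g r t x = h r x) {r t : α} (hr : r ∈ S) (ht : t ∈ S) :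
    ∑ x ∈ T, p t x / m t * g r t x = ∑ x ∈ T, q x * h r x := by
  refine Finset.sum_congr rfl fun x hx => ?_
  rw [hp t ht x hx, hg r hr t ht x hx, mul_div_cancel_left₀ _ (hm t ht).ne']

/-- If the payoff from a report does not depend on the true type, truthful reporting can be optimal
for every type only when the truthful payoff is constant. -/
theorem exists_forall_eq_of_report_only {α : Type*} {S : Finset α} {U : α → α → ℝ} {F : α → ℝ}
    (hS : S.Nonempty) (hU : ∀ r ∈ S, ∀ t ∈ S, U r t = F r)
    (hIC : ∀ t ∈ S, ∀ r ∈ S, U r t ≤ U t t) : ∃ v, ∀ t ∈ S, U t t = v := by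
  obtain ⟨a, ha⟩ := hS
  have key : ∀ t ∈ S, ∀ r ∈ S, F r ≤ F t := fun t ht r hr => by
    simpa only [hU r hr t ht, hU t ht t ht] using hIC t ht r hr
  exact ⟨F a, fun t ht => (hU t ht t ht).trans (le_antisymm (key a ha t ht) (key t ht a ha))⟩

/-- **Proposition 5 (if-part).**  If `f` has full support and is independent, then any incentive
compatible mechanism that never selects the disagreement outcome (as any efficient mechanism
must) is ordinal. -/
theorem independent_efficient_implies_ordinal (n : ℕ) (hn : 2 ≤ n)
    (T₁ T₂ : Finset ℝ) (hT₁ : T₁.Nonempty) (hT₂ : T₂.Nonempty)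
    (u₁ u₂ : Fin n → ℝ)
    (hnorm : u₁ ⟨0, by omega⟩ = 1 ∧ u₂ ⟨0, by omega⟩ = 0 ∧
      u₁ ⟨1, by omega⟩ = 0 ∧ u₂ ⟨1, by omega⟩ = 1)
    (f : ℝ × ℝ → ℝ) (hf : IsPrior T₁ T₂ f)
    (hfull : ∀ t₁ ∈ T₁, ∀ t₂ ∈ T₂, 0 < f (t₁, t₂))
    (hind : ∀ t₁ ∈ T₁, ∀ t₂ ∈ T₂, f (t₁, t₂) = marg1 T₂ f t₁ * marg2 T₁ f t₂)
    (μ : ℝ × ℝ → Fin (n + 1) → ℝ)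
    (hfeas : Feasible T₁ T₂ μ) (hIC : IC T₁ T₂ f u₁ u₂ μ)
    (h0 : ∀ t₁ ∈ T₁, ∀ t₂ ∈ T₂, μ (t₁, t₂) 0 = 0) :
    OrdinalMech T₁ T₂ f u₁ u₂ μ := by
  obtain ⟨-, -, hm₁, hm₂⟩ := hf
  obtain ⟨v₁, hv₁⟩ := exists_forall_eq_of_report_only hT₁ (U := interim1 T₂ f u₁ μ)
    (fun r hr t ht => sum_div_mul_eq_of_weights_eq (p := fun t₁ t₂ => f (t₁, t₂))
      (g := fun r t x => u1post u₁ μ (r, x) (t, x))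
      (h := fun r x => ∑ k : Fin n, μ (r, x) k.succ * u₁ k) hm₁ hind
      (fun r hr t _ x hx => by simp [u1post, h0 r hr x hx]) hr ht) hIC.1
  obtain ⟨v₂, hv₂⟩ := exists_forall_eq_of_report_only hT₂ (U := interim2 T₁ f u₂ μ)
    (fun r hr t ht => sum_div_mul_eq_of_weights_eq (p := fun t₂ t₁ => f (t₁, t₂))
      (g := fun r t x => u2post u₂ μ (x, r) (x, t))
      (h := fun r x => ∑ k : Fin n, μ (x, r) k.succ * u₂ k) hm₂
      (fun t ht x hx => (hind x hx t ht).trans (mul_comm _ _))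
      (fun r hr t _ x hx => by simp [u2post, h0 x hx r hr]) hr ht) hIC.2
  exact ⟨v₁, v₂, hv₁, hv₂⟩
end
end

section
/- Suppose f has full support and is independent (f(t_1,t_2) = f_1(t_1) f_2(t_2) for all t). If μ is an incentive compatible and ordinal mechanism, then μ^0(t) = 0 for every t ∈ T with t ≠ (max T_1, max T_2); that is, an ordinal mechanism can select the disagreement outcome with positive probability only at the state where both players have their highest disagreement value. -/
open Finset

noncomputable section

/-- Under an independent prior, misreporting shifts the interim utility of player 1 by the
difference in types times the interim probability of disagreement. -/
theorem interim1_sub_interim1 {T₁ T₂ : Finset ℝ} {f : ℝ × ℝ → ℝ}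
    (hpos : ∀ t₁ ∈ T₁, 0 < marg1 T₂ f t₁)
    (hind : ∀ t₁ ∈ T₁, ∀ t₂ ∈ T₂, f (t₁, t₂) = marg1 T₂ f t₁ * marg2 T₁ f t₂)
    {n : ℕ} (u₁ : Fin n → ℝ) (μ : ℝ × ℝ → Fin (n + 1) → ℝ)
    {r t : ℝ} (hr : r ∈ T₁) (ht : t ∈ T₁) :
    interim1 T₂ f u₁ μ r t - interim1 T₂ f u₁ μ r r =
      (t - r) * ∑ t₂ ∈ T₂, marg2 T₁ f t₂ * μ (r, t₂) 0 := by
  unfold interim1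
  rw [← Finset.sum_sub_distrib, Finset.mul_sum]
  refine Finset.sum_congr rfl fun s hs => ?_
  rw [hind t ht s hs, hind r hr s hs, mul_div_cancel_left₀ _ (hpos t ht).ne',
    mul_div_cancel_left₀ _ (hpos r hr).ne']
  simp only [u1post]
  ring

/-- Under an independent prior, misreporting shifts the interim utility of player 2 by the
difference in types times the interim probability of disagreement. -/
theorem interim2_sub_interim2 {T₁ T₂ : Finset ℝ} {f : ℝ × ℝ → ℝ}
    (hpos : ∀ t₂ ∈ T₂, 0 < marg2 T₁ f t₂)
    (hind : ∀ t₁ ∈ T₁, ∀ t₂ ∈ T₂, f (t₁, t₂) = marg1 T₂ f t₁ * marg2 T₁ f t₂)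
    {n : ℕ} (u₂ : Fin n → ℝ) (μ : ℝ × ℝ → Fin (n + 1) → ℝ)
    {r t : ℝ} (hr : r ∈ T₂) (ht : t ∈ T₂) :
    interim2 T₁ f u₂ μ r t - interim2 T₁ f u₂ μ r r =
      (t - r) * ∑ t₁ ∈ T₁, marg1 T₂ f t₁ * μ (t₁, r) 0 := by
  unfold interim2
  rw [← Finset.sum_sub_distrib, Finset.mul_sum]
  refine Finset.sum_congr rfl fun s hs => ?_
  rw [hind s hs t ht, hind s hs r hr, mul_div_cancel_right₀ _ (hpos t ht).ne',
    mul_div_cancel_right₀ _ (hpos r hr).ne']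
  simp only [u2post]
  ring

/-- If a positively weighted sum of nonnegative terms becomes nonpositive after scaling by a
positive factor, then every term vanishes. -/
theorem eq_zero_of_mul_sum_nonpos {ι : Type*} {S : Finset ι} {w p : ι → ℝ} {c : ℝ}
    (hc : 0 < c) (hw : ∀ i ∈ S, 0 < w i) (hp : ∀ i ∈ S, 0 ≤ p i)
    (h : c * ∑ i ∈ S, w i * p i ≤ 0) {i : ι} (hi : i ∈ S) : p i = 0 := by
  have hnn : ∀ j ∈ S, 0 ≤ w j * p j := fun j hj => mul_nonneg (hw j hj).le (hp j hj)
  have hsum : ∑ j ∈ S, w j * p j = 0 :=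
    le_antisymm (nonpos_of_mul_nonpos_right h hc) (Finset.sum_nonneg hnn)
  exact (mul_eq_zero.mp ((Finset.sum_eq_zero_iff_of_nonneg hnn).mp hsum i hi)).resolve_left
    (hw i hi).ne'

/-- **Proposition 5 (only-if part).**  If `f` has full support and is independent, an incentive
compatible ordinal mechanism can put positive probability on the disagreement outcome only at the
top state `(max T₁, max T₂)`. -/
theorem ordinal_disagreement_only_at_top (n : ℕ) (hn : 2 ≤ n)
    (T₁ T₂ : Finset ℝ) (hT₁ : T₁.Nonempty) (hT₂ : T₂.Nonempty)
    (u₁ u₂ : Fin n → ℝ)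
    (hnorm : u₁ ⟨0, by omega⟩ = 1 ∧ u₂ ⟨0, by omega⟩ = 0 ∧
      u₁ ⟨1, by omega⟩ = 0 ∧ u₂ ⟨1, by omega⟩ = 1)
    (f : ℝ × ℝ → ℝ) (hf : IsPrior T₁ T₂ f)
    (hfull : ∀ t₁ ∈ T₁, ∀ t₂ ∈ T₂, 0 < f (t₁, t₂))
    (hind : ∀ t₁ ∈ T₁, ∀ t₂ ∈ T₂, f (t₁, t₂) = marg1 T₂ f t₁ * marg2 T₁ f t₂)
    (μ : ℝ × ℝ → Fin (n + 1) → ℝ)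
    (hfeas : Feasible T₁ T₂ μ) (hIC : IC T₁ T₂ f u₁ u₂ μ)
    (hord : OrdinalMech T₁ T₂ f u₁ u₂ μ) :
    ∀ t₁ ∈ T₁, ∀ t₂ ∈ T₂, (t₁, t₂) ≠ (T₁.max' hT₁, T₂.max' hT₂) → μ (t₁, t₂) 0 = 0 := by
  obtain ⟨-, -, hm₁, hm₂⟩ := hf
  obtain ⟨v₁, v₂, hv₁, hv₂⟩ := hord
  intro t₁ ht₁ t₂ ht₂ hne
  rcases (T₁.le_max' t₁ ht₁).lt_or_eq with hlt | heq₁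
  · have hM := T₁.max'_mem hT₁
    refine eq_zero_of_mul_sum_nonpos (p := fun s => μ (t₁, s) 0) (sub_pos.mpr hlt) hm₂
      (fun s hs => (hfeas t₁ ht₁ s hs).1 0) ?_ ht₂
    rw [← interim1_sub_interim1 hm₁ hind u₁ μ ht₁ hM, hv₁ t₁ ht₁, ← hv₁ _ hM]
    exact sub_nonpos.mpr (hIC.1 _ hM t₁ ht₁)
  rcases (T₂.le_max' t₂ ht₂).lt_or_eq with hlt | heq₂
  · have hM := T₂.max'_mem hT₂
    refine eq_zero_of_mul_sum_nonpos (p := fun s => μ (s, t₂) 0) (sub_pos.mpr hlt) hm₁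
      (fun s hs => (hfeas s hs t₂ ht₂).1 0) ?_ ht₁
    rw [← interim2_sub_interim2 hm₂ hind u₂ μ ht₂ hM, hv₂ t₂ ht₂, ← hv₂ _ hM]
    exact sub_nonpos.mpr (hIC.2 _ hM t₂ ht₂)
  · exact absurd (Prod.ext heq₁ heq₂) hne
end
end

section
/- Suppose f has full support and min(|T_1|, |T_2|) = 2. Then every incentive compatible efficient mechanism μ (μ^0(t) = 0 and (u_1^μ(t), u_2^μ(t)) ∈ ∂V for all t ∈ T) is ordinal: for each player i, U_i^μ(t_i) is the same for all t_i ∈ T_i. (This holds for an arbitrary, in particular non-linear, Pareto frontier ∂V.) -/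
open Finset

noncomputable section

/-- Two points of the Pareto frontier are ordered oppositely by the two players. -/
lemma fst_lt_iff_of_mem_paretoV {n : ℕ} {u₁ u₂ : Fin n → ℝ} {v w : ℝ × ℝ}
    (hv : v ∈ paretoV u₁ u₂) (hw : w ∈ paretoV u₁ u₂) : v.1 < w.1 ↔ w.2 < v.2 := by
  constructor <;> intro h <;> by_contra! h'
  · exact hv.2 ⟨w, hw.1, h.le, h', fun e => by simp [e] at h⟩
  · exact hw.2 ⟨v, hv.1, h', h.le, fun e => by simp [e] at h⟩

/-- If `d` and the ratio `p / q` are oppositely ordered, but `d` has nonnegative `p`-mean and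
nonpositive `q`-mean, then `p / q` does not vary between points where `d` differs. -/
lemma mul_eq_mul_of_antitone_ratio {ι : Type*} {s : Finset ι} {p q d : ι → ℝ}
    (hp : ∀ j ∈ s, 0 < p j) (hq : ∀ j ∈ s, 0 < q j)
    (hpd : 0 ≤ ∑ j ∈ s, p j * d j) (hqd : ∑ j ∈ s, q j * d j ≤ 0)
    (hanti : ∀ j ∈ s, ∀ k ∈ s, d j < d k → p k * q j ≤ p j * q k) :
    ∀ j ∈ s, ∀ k ∈ s, d j ≠ d k → p j * q k = p k * q j := by
  have hterm : ∀ j ∈ s, ∀ k ∈ s, 0 ≤ (d k - d j) * (p j * q k - p k * q j) := by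
    intro j hj k hk
    rcases lt_trichotomy (d j) (d k) with h | h | h
    · exact mul_nonneg (by linarith) (by linarith [hanti j hj k hk h])
    · simp [h]
    · exact mul_nonneg_of_nonpos_of_nonpos (by linarith) (by linarith [hanti k hk j hj h])
  have hsum : ∑ j ∈ s, ∑ k ∈ s, (d k - d j) * (p j * q k - p k * q j) =
      2 * ((∑ j ∈ s, p j) * (∑ j ∈ s, q j * d j) -
        (∑ j ∈ s, p j * d j) * (∑ j ∈ s, q j)) := by
    have h (j k : ι) : (d k - d j) * (p j * q k - p k * q j) =
        p j * (q k * d k) - q j * (p k * d k) - (p j * d j) * q k + (q j * d j) * p k := by ring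
    simp only [h, Finset.sum_add_distrib, Finset.sum_sub_distrib, ← Finset.mul_sum,
      ← Finset.sum_mul]
    ring
  have hzero : ∑ j ∈ s, ∑ k ∈ s, (d k - d j) * (p j * q k - p k * q j) = 0 := by
    refine le_antisymm ?_ (Finset.sum_nonneg fun j hj => Finset.sum_nonneg (hterm j hj))
    have h₁ := mul_nonneg (Finset.sum_nonneg fun j hj => (hp j hj).le) (neg_nonneg.2 hqd)
    have h₂ := mul_nonneg hpd (Finset.sum_nonneg fun j hj => (hq j hj).le)
    linarith
  intro j hj k hk hd
  have h := (Finset.sum_eq_zero_iff_of_nonneg (hterm j hj)).1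
    ((Finset.sum_eq_zero_iff_of_nonneg fun j hj => Finset.sum_nonneg (hterm j hj)).1 hzero j hj)
    k hk
  rcases mul_eq_zero.1 h with h | h
  · exact absurd (by linarith) hd
  · linarith

/-- In a correlated equilibrium with full support of a strictly competitive game with two rows,
either player 1's payoff is constant or the row weights `p` and `q` are proportional. -/
lemma payoff_const_or_weights_proportional {ι : Type*} {s : Finset ι} {p q α β A B : ι → ℝ}
    (hp : ∀ j ∈ s, 0 < p j) (hq : ∀ j ∈ s, 0 < q j)
    (hα : ∀ j ∈ s, ∀ k ∈ s, α j < α k ↔ A k < A j)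
    (hβ : ∀ j ∈ s, ∀ k ∈ s, β j < β k ↔ B k < B j)
    (hrow₁ : ∑ j ∈ s, p j * β j ≤ ∑ j ∈ s, p j * α j)
    (hrow₂ : ∑ j ∈ s, q j * α j ≤ ∑ j ∈ s, q j * β j)
    (hcol : ∀ j ∈ s, ∀ k ∈ s, p j * A k + q j * B k ≤ p j * A j + q j * B j) :
    (∀ j ∈ s, ∀ k ∈ s, α j = α k ∧ α j = β k) ∨ ∃ c, 0 < c ∧ ∀ j ∈ s, p j = c * q j := by
  have hincomp : ∀ j ∈ s, ∀ k ∈ s, α j ≤ α k → β j ≤ β k → α j = α k ∧ β j = β k := by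
    intro j hj k hk h₁ h₂
    have hA : A k ≤ A j := not_lt.1 fun h => h₁.not_gt ((hα k hk j hj).2 h)
    have hB : B k ≤ B j := not_lt.1 fun h => h₂.not_gt ((hβ k hk j hj).2 h)
    have hk' := hcol k hk j hj
    have hpA := mul_le_mul_of_nonneg_left hA (hp k hk).le
    have hqB := mul_le_mul_of_nonneg_left hB (hq k hk).le
    constructor
    · refine h₁.eq_of_not_lt fun h => ?_
      have := mul_lt_mul_of_pos_left ((hα j hj k hk).1 h) (hp k hk)
      linarith
    · refine h₂.eq_of_not_lt fun h => ?_
      have := mul_lt_mul_of_pos_left ((hβ j hj k hk).1 h) (hq k hk)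
      linarith
  have hanti : ∀ j ∈ s, ∀ k ∈ s, α j - β j < α k - β k → p k * q j ≤ p j * q k := by
    intro j hj k hk hd
    have h₁ : α j < α k := by
      by_contra! h
      linarith [(hincomp k hk j hj h (by linarith)).1, (hincomp k hk j hj h (by linarith)).2]
    have h₂ : β k < β j := by
      by_contra! h
      linarith [(hincomp j hj k hk h₁.le h).1]
    have hA := (hα j hj k hk).1 h₁
    have hB := (hβ k hk j hj).1 h₂
    have hj' := mul_le_mul_of_nonneg_left (hcol j hj k hk) (hq k hk).le
    have hk' := mul_le_mul_of_nonneg_left (hcol k hk j hj) (hq j hj).le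
    refine le_of_mul_le_mul_right ?_ (sub_pos.2 hA)
    linarith
  have hratio := mul_eq_mul_of_antitone_ratio (d := fun j => α j - β j) hp hq
    (by simpa [mul_sub] using hrow₁) (by simpa [mul_sub] using hrow₂) hanti
  by_cases hd : ∀ j ∈ s, ∀ k ∈ s, α j - β j = α k - β k
  · left
    have hαβ : ∀ j ∈ s, α j = β j := by
      intro j hj
      have hconst (w : ι → ℝ) : ∑ k ∈ s, w k * α k - ∑ k ∈ s, w k * β k =
          (∑ k ∈ s, w k) * (α j - β j) := by
        rw [← Finset.sum_sub_distrib, Finset.sum_mul]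
        exact Finset.sum_congr rfl fun k hk => by rw [hd j hj k hk]; ring
      have hP := Finset.sum_pos hp ⟨j, hj⟩
      have hQ := Finset.sum_pos hq ⟨j, hj⟩
      have h₁ := nonneg_of_mul_nonneg_right ((hconst p).symm ▸ sub_nonneg.2 hrow₁) hP
      have h₂ := nonpos_of_mul_nonpos_right ((hconst q).symm ▸ sub_nonpos.2 hrow₂) hQ
      linarith
    intro j hj k hk
    have hjk : α j = α k := by
      rcases le_total (α j) (α k) with h | h
      · exact (hincomp j hj k hk h (by rwa [← hαβ j hj, ← hαβ k hk])).1
      · exact (hincomp k hk j hj h (by rwa [← hαβ j hj, ← hαβ k hk])).1.symm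
    exact ⟨hjk, hjk.trans (hαβ k hk)⟩
  · right
    push Not at hd
    obtain ⟨j, hj, k, hk, hjk⟩ := hd
    refine ⟨p j / q j, div_pos (hp j hj) (hq j hj), fun l hl => ?_⟩
    have hqj := (hq j hj).ne'
    have hjk' := hratio j hj k hk hjk
    field_simp
    by_cases hlj : α l - β l = α j - β j
    · have hlk := hratio l hl k hk (hlj ▸ hjk)
      refine mul_right_cancel₀ (hq k hk).ne' ?_
      linear_combination q j * hlk - q l * hjk'
    · exact hratio l hl j hj hlj

/-- Weighted averages with respect to weights given by a type-dependent distribution are constant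
in the type when the distributions coincide and truthful reporting is optimal. -/
lemma exists_const_of_common_belief {ι κ : Type*} {S : Finset ι} {T : Finset κ}
    (hT : T.Nonempty) {w x : κ → ι → ℝ}
    (hw : ∀ t ∈ T, ∀ t' ∈ T, ∀ s ∈ S, w t s = w t' s)
    (hIC : ∀ t ∈ T, ∀ r ∈ T, ∑ s ∈ S, w t s * x r s ≤ ∑ s ∈ S, w t s * x t s) :
    ∃ v, ∀ t ∈ T, ∑ s ∈ S, w t s * x t s = v := by
  obtain ⟨a, ha⟩ := hT
  refine ⟨∑ s ∈ S, w a s * x a s, fun t ht => ?_⟩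
  have h (r : κ) : ∑ s ∈ S, w t s * x r s = ∑ s ∈ S, w a s * x r s :=
    Finset.sum_congr rfl fun s hs => by rw [hw t ht a ha s hs]
  exact le_antisymm (h t ▸ hIC a ha t ht) (h a ▸ hIC t ht a ha)

/-- A correlated equilibrium with full support of a strictly competitive game in which the first
player has two strategies gives each player the same expected payoff at every strategy. -/
lemma exists_interim_const_of_card_eq_two {T S : Finset ℝ} (hT : T.card = 2) (hS : S.Nonempty)
    {f x y : ℝ → ℝ → ℝ} (hf : ∀ t ∈ T, ∀ s ∈ S, 0 < f t s)
    (hxy : ∀ t ∈ T, ∀ t' ∈ T, ∀ s ∈ S, ∀ s' ∈ S, x t s < x t' s' ↔ y t' s' < y t s)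
    (hx : ∀ t ∈ T, ∀ r ∈ T, ∑ s ∈ S, f t s / (∑ s ∈ S, f t s) * x r s ≤
      ∑ s ∈ S, f t s / (∑ s ∈ S, f t s) * x t s)
    (hy : ∀ s ∈ S, ∀ r ∈ S, ∑ t ∈ T, f t s / (∑ t ∈ T, f t s) * y t r ≤
      ∑ t ∈ T, f t s / (∑ t ∈ T, f t s) * y t s) :
    (∃ v, ∀ t ∈ T, ∑ s ∈ S, f t s / (∑ s ∈ S, f t s) * x t s = v) ∧
      ∃ v, ∀ s ∈ S, ∑ t ∈ T, f t s / (∑ t ∈ T, f t s) * y t s = v := by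
  have hTne : T.Nonempty := Finset.card_pos.1 (by omega)
  obtain ⟨a, b, hab, rfl⟩ := Finset.card_eq_two.1 hT
  have ha : a ∈ ({a, b} : Finset ℝ) := by simp
  have hb : b ∈ ({a, b} : Finset ℝ) := by simp
  have hrow : ∀ t ∈ ({a, b} : Finset ℝ), 0 < ∑ s ∈ S, f t s :=
    fun t ht => Finset.sum_pos (hf t ht) hS
  have hcol : ∀ s ∈ S, 0 < ∑ t ∈ {a, b}, f t s :=
    fun s hs => Finset.sum_pos (fun t ht => hf t ht s hs) hTne
  have hx' : ∀ t ∈ ({a, b} : Finset ℝ), ∀ r ∈ ({a, b} : Finset ℝ),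
      ∑ s ∈ S, f t s * x r s ≤ ∑ s ∈ S, f t s * x t s := by
    intro t ht r hr
    have h := hx t ht r hr
    simp only [div_mul_eq_mul_div, ← Finset.sum_div] at h
    exact (div_le_div_iff_of_pos_right (hrow t ht)).1 h
  have hy' : ∀ s ∈ S, ∀ r ∈ S,
      f a s * y a r + f b s * y b r ≤ f a s * y a s + f b s * y b s := by
    intro s hs r hr
    have h := hy s hs r hr
    simp only [div_mul_eq_mul_div, ← Finset.sum_div] at h
    simpa [Finset.sum_pair hab] using (div_le_div_iff_of_pos_right (hcol s hs)).1 h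
  rcases payoff_const_or_weights_proportional (hf a ha) (hf b hb) (hxy a ha a ha) (hxy b hb b hb)
    (hx' a ha b hb) (hx' b hb a ha) hy' with hconst | ⟨c, hc, hprop⟩
  · obtain ⟨s₀, hs₀⟩ := hS
    have hx₀ : ∀ t ∈ ({a, b} : Finset ℝ), ∀ s ∈ S, x t s = x a s₀ := by
      intro t ht s hs
      rcases Finset.mem_insert.1 ht with rfl | ht
      · exact (hconst s hs s₀ hs₀).1
      · rw [Finset.mem_singleton.1 ht]
        exact (hconst s₀ hs₀ s hs).2.symm
    have hy₀ : ∀ t ∈ ({a, b} : Finset ℝ), ∀ s ∈ S, y t s = y a s₀ := by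
      intro t ht s hs
      refine le_antisymm (not_lt.1 fun h => ?_) (not_lt.1 fun h => ?_)
      · exact ((hxy t ht a ha s hs s₀ hs₀).2 h).ne (hx₀ t ht s hs)
      · exact ((hxy a ha t ht s₀ hs₀ s hs).2 h).ne' (hx₀ t ht s hs)
    refine ⟨⟨x a s₀, fun t ht => ?_⟩, ⟨y a s₀, fun s hs => ?_⟩⟩
    · rw [Finset.sum_congr rfl fun s hs => by rw [hx₀ t ht s hs], ← Finset.sum_mul,
        ← Finset.sum_div, div_self (hrow t ht).ne', one_mul]
    · rw [Finset.sum_congr rfl fun t ht => by rw [hy₀ t ht s hs], ← Finset.sum_mul,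
        ← Finset.sum_div, div_self (hcol s hs).ne', one_mul]
  · refine ⟨exists_const_of_common_belief hTne (fun t ht t' ht' s hs => ?_) hx,
      exists_const_of_common_belief (w := fun s t => f t s / ∑ t ∈ {a, b}, f t s)
        (x := fun s t => y t s) hS (fun s hs s' hs' t ht => ?_) hy⟩
    · have h : ∀ t ∈ ({a, b} : Finset ℝ),
          f t s / ∑ s ∈ S, f t s = f b s / ∑ s ∈ S, f b s := by
        intro t ht
        rcases Finset.mem_insert.1 ht with rfl | ht
        · rw [Finset.sum_congr rfl hprop, hprop s hs, ← Finset.mul_sum,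
            mul_div_mul_left _ _ hc.ne']
        · rw [Finset.mem_singleton.1 ht]
      rw [h t ht, h t' ht']
    · have hs₁ := hf b hb s hs
      have hs₂ := hf b hb s' hs'
      simp only [Finset.sum_pair hab, hprop s hs, hprop s' hs']
      rw [div_eq_div_iff (by positivity) (by positivity)]
      rcases Finset.mem_insert.1 ht with rfl | ht
      · rw [hprop s hs, hprop s' hs']
        ring
      · rw [Finset.mem_singleton.1 ht]
        ring

/-- **Theorem 2 (first part).**  If `f` has full support and one of the players has exactly two
types (`min(|T₁|, |T₂|) = 2`), then every incentive compatible efficient mechanism is ordinal,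
for an arbitrary (possibly non-linear) Pareto frontier `∂V`. -/
theorem twoTypes_efficient_implies_ordinal (n : ℕ) (hn : 2 ≤ n)
    (T₁ T₂ : Finset ℝ) (hT₁ : T₁.Nonempty) (hT₂ : T₂.Nonempty)
    (hcard : min T₁.card T₂.card = 2)
    (u₁ u₂ : Fin n → ℝ)
    (hnorm : u₁ ⟨0, by omega⟩ = 1 ∧ u₂ ⟨0, by omega⟩ = 0 ∧
      u₁ ⟨1, by omega⟩ = 0 ∧ u₂ ⟨1, by omega⟩ = 1)
    (f : ℝ × ℝ → ℝ) (hf : IsPrior T₁ T₂ f)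
    (hfull : ∀ t₁ ∈ T₁, ∀ t₂ ∈ T₂, 0 < f (t₁, t₂))
    (μ : ℝ × ℝ → Fin (n + 1) → ℝ)
    (hfeas : Feasible T₁ T₂ μ) (hIC : IC T₁ T₂ f u₁ u₂ μ)
    (heff : ∀ t₁ ∈ T₁, ∀ t₂ ∈ T₂, μ (t₁, t₂) 0 = 0 ∧
      (u1post u₁ μ (t₁, t₂) (t₁, t₂), u2post u₂ μ (t₁, t₂) (t₁, t₂)) ∈ paretoV u₁ u₂) :
    OrdinalMech T₁ T₂ f u₁ u₂ μ := by
  have hx : ∀ t ∈ T₁, ∀ r ∈ T₁, interim1 T₂ f u₁ μ r t =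
      ∑ s ∈ T₂, f (t, s) / (∑ s ∈ T₂, f (t, s)) * u1post u₁ μ (r, s) (r, s) := fun t _ r hr =>
    Finset.sum_congr rfl fun s hs => by simp [marg1, u1post, (heff r hr s hs).1]
  have hy : ∀ s ∈ T₂, ∀ r ∈ T₂, interim2 T₁ f u₂ μ r s =
      ∑ t ∈ T₁, f (t, s) / (∑ t ∈ T₁, f (t, s)) * u2post u₂ μ (t, r) (t, r) := fun s _ r hr =>
    Finset.sum_congr rfl fun t ht => by simp [marg2, u2post, (heff t ht r hr).1]
  have hICx : ∀ t ∈ T₁, ∀ r ∈ T₁,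
      ∑ s ∈ T₂, f (t, s) / (∑ s ∈ T₂, f (t, s)) * u1post u₁ μ (r, s) (r, s) ≤
        ∑ s ∈ T₂, f (t, s) / (∑ s ∈ T₂, f (t, s)) * u1post u₁ μ (t, s) (t, s) := by
    intro t ht r hr
    rw [← hx t ht r hr, ← hx t ht t ht]
    exact hIC.1 t ht r hr
  have hICy : ∀ s ∈ T₂, ∀ r ∈ T₂,
      ∑ t ∈ T₁, f (t, s) / (∑ t ∈ T₁, f (t, s)) * u2post u₂ μ (t, r) (t, r) ≤
        ∑ t ∈ T₁, f (t, s) / (∑ t ∈ T₁, f (t, s)) * u2post u₂ μ (t, s) (t, s) := by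
    intro s hs r hr
    rw [← hy s hs r hr, ← hy s hs s hs]
    exact hIC.2 s hs r hr
  have hopp : ∀ t ∈ T₁, ∀ t' ∈ T₁, ∀ s ∈ T₂, ∀ s' ∈ T₂,
      u1post u₁ μ (t, s) (t, s) < u1post u₁ μ (t', s') (t', s') ↔
        u2post u₂ μ (t', s') (t', s') < u2post u₂ μ (t, s) (t, s) :=
    fun t ht t' ht' s hs s' hs' =>
      fst_lt_iff_of_mem_paretoV (heff t ht s hs).2 (heff t' ht' s' hs').2
  have key : (∃ v, ∀ t ∈ T₁,
        ∑ s ∈ T₂, f (t, s) / (∑ s ∈ T₂, f (t, s)) * u1post u₁ μ (t, s) (t, s) = v) ∧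
      ∃ v, ∀ s ∈ T₂,
        ∑ t ∈ T₁, f (t, s) / (∑ t ∈ T₁, f (t, s)) * u2post u₂ μ (t, s) (t, s) = v := by
    rcases min_choice T₁.card T₂.card with h | h
    · exact exists_interim_const_of_card_eq_two (f := fun t s => f (t, s))
        (x := fun t s => u1post u₁ μ (t, s) (t, s)) (y := fun t s => u2post u₂ μ (t, s) (t, s))
        (h.symm.trans hcard) hT₂ hfull hopp hICx hICy
    · exact (exists_interim_const_of_card_eq_two (f := fun s t => f (t, s))
        (x := fun s t => u2post u₂ μ (t, s) (t, s)) (y := fun s t => u1post u₁ μ (t, s) (t, s))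
        (h.symm.trans hcard) hT₁ (fun s hs t ht => hfull t ht s hs)
        (fun s hs s' hs' t ht t' ht' => (hopp t' ht' t ht s' hs' s hs).symm) hICy hICx).symm
  obtain ⟨⟨v₁, hv₁⟩, ⟨v₂, hv₂⟩⟩ := key
  exact ⟨v₁, v₂, fun t ht => (hx t ht t ht).trans (hv₁ t ht),
    fun s hs => (hy s hs s hs).trans (hv₂ s hs)⟩
end
end

section
/- In the pure-conflict case A = {a_0, a_1, a_2}, assume t_1 + t_2 < 1 for all (t_1,t_2) ∈ T, f has full support and is independent (f(t_1,t_2) = f_1(t_1) f_2(t_2)), and at least one player has two or more types (max(|T_1|, |T_2|) ≥ 2). If μ is an incentive compatible mechanism that is egalitarian, i.e., U_1^μ(t_1) − t_1 = U_2^μ(t_2) − t_2 for all t_1 ∈ T_1 and t_2 ∈ T_2, then μ selects the disagreement outcome with probability 1: μ^0(t) = 1 for all t ∈ T. -/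
open Finset

noncomputable section

/-- If a player with at least two types has the same gain `c` over disagreement at every type,
incentive compatibility forces `c = 0`. -/
theorem gain_eq_zero_of_two_types (T S : Finset ℝ) (hT : 2 ≤ T.card) (q : ℝ → ℝ)
    (hq : ∀ s ∈ S, 0 < q s) (hq1 : ∑ s ∈ S, q s = 1) (a x : ℝ → ℝ → ℝ)
    (ha : ∀ t ∈ T, ∀ s ∈ S, 0 ≤ a t s) (hax : ∀ t ∈ T, ∀ s ∈ S, a t s + x t s ≤ 1)
    (hIC : ∀ t ∈ T, ∀ r ∈ T,
      ∑ s ∈ S, q s * (a r s + x r s * t) ≤ ∑ s ∈ S, q s * (a t s + x t s * t))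
    (c : ℝ) (hc : ∀ t ∈ T, ∑ s ∈ S, q s * (a t s + x t s * t) - t = c) : c = 0 := by
  obtain ⟨t, ht, t', ht', hlt⟩ : ∃ t ∈ T, ∃ t' ∈ T, t < t' := by
    obtain ⟨t, ht, t', ht', hne⟩ := Finset.one_lt_card.1 hT
    rcases lt_or_gt_of_ne hne with h | h
    · exact ⟨t, ht, t', ht', h⟩
    · exact ⟨t', ht', t, ht, h⟩
  have expand : ∀ r t, ∑ s ∈ S, q s * (a r s + x r s * t)
      = ∑ s ∈ S, q s * a r s + (∑ s ∈ S, q s * x r s) * t := by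
    intro r t
    rw [Finset.sum_mul, ← Finset.sum_add_distrib]
    exact Finset.sum_congr rfl fun s _ => by ring
  have hA : 0 ≤ ∑ s ∈ S, q s * a t' s :=
    Finset.sum_nonneg fun s hs => mul_nonneg (hq s hs).le (ha t' ht' s hs)
  have hAX : ∑ s ∈ S, q s * a t' s + ∑ s ∈ S, q s * x t' s ≤ 1 := by
    rw [← hq1, ← Finset.sum_add_distrib]
    exact Finset.sum_le_sum fun s hs => by nlinarith [hq s hs, hax t' ht' s hs]
  have h := hIC t ht t' ht'
  have hct := hc t ht
  have hct' := hc t' ht'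
  rw [expand] at h hct'
  have hX : 1 ≤ ∑ s ∈ S, q s * x t' s := by
    refine le_of_mul_le_mul_right (a := t' - t) ?_ (sub_pos.2 hlt)
    linarith
  have hX1 : ∑ s ∈ S, q s * x t' s = 1 := by linarith
  rw [hX1] at hct' hAX
  linarith

/-- If both players gain nothing over disagreement at any type and disagreement is always
inefficient, then disagreement has probability one. -/
theorem disagreement_of_zero_gains (T S : Finset ℝ) (p q : ℝ → ℝ)
    (hp : ∀ t ∈ T, 0 < p t) (hq : ∀ s ∈ S, 0 < q s)
    (hp1 : ∑ t ∈ T, p t = 1) (hq1 : ∑ s ∈ S, q s = 1) (a b x : ℝ → ℝ → ℝ)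
    (ha : ∀ t ∈ T, ∀ s ∈ S, 0 ≤ a t s) (hb : ∀ t ∈ T, ∀ s ∈ S, 0 ≤ b t s)
    (habx : ∀ t ∈ T, ∀ s ∈ S, a t s + b t s + x t s = 1)
    (hdis : ∀ t ∈ T, ∀ s ∈ S, t + s < 1)
    (h₁ : ∀ t ∈ T, ∑ s ∈ S, q s * (a t s + x t s * t) - t = 0)
    (h₂ : ∀ s ∈ S, ∑ t ∈ T, p t * (b t s + x t s * s) - s = 0) :
    ∀ t ∈ T, ∀ s ∈ S, x t s = 1 := by
  have e₁ : ∑ t ∈ T, ∑ s ∈ S, p t * q s * (a t s + x t s * t - t) = 0 := by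
    refine Finset.sum_eq_zero fun t ht => ?_
    calc ∑ s ∈ S, p t * q s * (a t s + x t s * t - t)
        = p t * (∑ s ∈ S, q s * (a t s + x t s * t) - (∑ s ∈ S, q s) * t) := by
          rw [Finset.sum_mul, ← Finset.sum_sub_distrib, Finset.mul_sum]
          exact Finset.sum_congr rfl fun s _ => by ring
      _ = 0 := by rw [hq1, one_mul, h₁ t ht, mul_zero]
  have e₂ : ∑ t ∈ T, ∑ s ∈ S, p t * q s * (b t s + x t s * s - s) = 0 := by
    rw [Finset.sum_comm]
    refine Finset.sum_eq_zero fun s hs => ?_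
    calc ∑ t ∈ T, p t * q s * (b t s + x t s * s - s)
        = q s * (∑ t ∈ T, p t * (b t s + x t s * s) - (∑ t ∈ T, p t) * s) := by
          rw [Finset.sum_mul, ← Finset.sum_sub_distrib, Finset.mul_sum]
          exact Finset.sum_congr rfl fun t _ => by ring
      _ = 0 := by rw [hp1, one_mul, h₂ s hs, mul_zero]
  have e : ∑ t ∈ T, ∑ s ∈ S, p t * q s * ((1 - x t s) * (1 - (t + s))) = 0 := by
    rw [← add_zero (0 : ℝ)]
    nth_rewrite 2 [← e₁]
    rw [← e₂, ← Finset.sum_add_distrib]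
    refine Finset.sum_congr rfl fun t ht => ?_
    rw [← Finset.sum_add_distrib]
    refine Finset.sum_congr rfl fun s hs => ?_
    linear_combination - (p t * q s) * habx t ht s hs
  have hpos : ∀ t ∈ T, ∀ s ∈ S, 0 ≤ p t * q s * ((1 - x t s) * (1 - (t + s))) :=
    fun t ht s hs => mul_nonneg (mul_pos (hp t ht) (hq s hs)).le <| mul_nonneg
      (by linarith [ha t ht s hs, hb t ht s hs, habx t ht s hs]) (by linarith [hdis t ht s hs])
  intro t ht s hs
  have e' := (Finset.sum_eq_zero_iff_of_nonneg fun t ht => Finset.sum_nonneg (hpos t ht)).1 e t ht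
  have e'' := (Finset.sum_eq_zero_iff_of_nonneg (hpos t ht)).1 e' s hs
  have := hp t ht
  have := hq s hs
  have := hdis t ht s hs
  have h : 1 - x t s = 0 := by
    rcases mul_eq_zero.1 e'' with h | h
    · exact absurd h (by positivity)
    · exact (mul_eq_zero.1 h).resolve_right (by linarith)
  linarith

/-- **Proposition 8.**  In the pure-conflict case with full-support independent beliefs (and at
least one player having two or more types), an incentive compatible egalitarian mechanism must
select the disagreement outcome with probability `1`. -/
theorem egalitarian_implies_disagreement
    (T₁ T₂ : Finset ℝ) (hT₁ : T₁.Nonempty) (hT₂ : T₂.Nonempty)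
    (hcard : 2 ≤ max T₁.card T₂.card)
    (u₁ u₂ : Fin 2 → ℝ)
    (hnorm : u₁ 0 = 1 ∧ u₂ 0 = 0 ∧ u₁ 1 = 0 ∧ u₂ 1 = 1)
    (hdis : ∀ t₁ ∈ T₁, ∀ t₂ ∈ T₂, t₁ + t₂ < 1)
    (f : ℝ × ℝ → ℝ) (hf : IsPrior T₁ T₂ f)
    (hfull : ∀ t₁ ∈ T₁, ∀ t₂ ∈ T₂, 0 < f (t₁, t₂))
    (hind : ∀ t₁ ∈ T₁, ∀ t₂ ∈ T₂, f (t₁, t₂) = marg1 T₂ f t₁ * marg2 T₁ f t₂)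
    (μ : ℝ × ℝ → Fin 3 → ℝ)
    (hfeas : Feasible T₁ T₂ μ) (hIC : IC T₁ T₂ f u₁ u₂ μ)
    (hegal : ∀ t₁ ∈ T₁, ∀ t₂ ∈ T₂,
      interim1 T₂ f u₁ μ t₁ t₁ - t₁ = interim2 T₁ f u₂ μ t₂ t₂ - t₂) :
    ∀ t₁ ∈ T₁, ∀ t₂ ∈ T₂, μ (t₁, t₂) 0 = 1 := by
  obtain ⟨h10, h20, h11, h21⟩ := hnorm
  obtain ⟨-, -, hm₁, hm₂⟩ := hf
  obtain ⟨hIC₁, hIC₂⟩ := hIC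
  have hq1 : ∑ s ∈ T₂, marg2 T₁ f s = 1 := by
    obtain ⟨t, ht⟩ := hT₁
    refine mul_left_cancel₀ (hm₁ t ht).ne' ?_
    rw [mul_one, Finset.mul_sum]
    exact Finset.sum_congr rfl fun s hs => (hind t ht s hs).symm
  have hp1 : ∑ t ∈ T₁, marg1 T₂ f t = 1 := by
    obtain ⟨s, hs⟩ := hT₂
    refine mul_right_cancel₀ (hm₂ s hs).ne' ?_
    rw [one_mul, Finset.sum_mul]
    exact Finset.sum_congr rfl fun t ht => (hind t ht s hs).symm
  have i₁ : ∀ t ∈ T₁, ∀ r, interim1 T₂ f u₁ μ r t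
      = ∑ s ∈ T₂, marg2 T₁ f s * (μ (r, s) 1 + μ (r, s) 0 * t) := by
    intro t ht r
    refine Finset.sum_congr rfl fun s hs => ?_
    rw [hind t ht s hs, mul_div_cancel_left₀ _ (hm₁ t ht).ne']
    simp [u1post, Fin.sum_univ_two, h10, h11]
  have i₂ : ∀ s ∈ T₂, ∀ r, interim2 T₁ f u₂ μ r s
      = ∑ t ∈ T₁, marg1 T₂ f t * (μ (t, r) 2 + μ (t, r) 0 * s) := by
    intro s hs r
    refine Finset.sum_congr rfl fun t ht => ?_
    rw [hind t ht s hs, mul_div_cancel_right₀ _ (hm₂ s hs).ne']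
    simp [u2post, Fin.sum_univ_two, h20, h21]
  have hnn : ∀ k, ∀ t ∈ T₁, ∀ s ∈ T₂, 0 ≤ μ (t, s) k := fun k t ht s hs => (hfeas t ht s hs).1 k
  have hsum : ∀ t ∈ T₁, ∀ s ∈ T₂, μ (t, s) 1 + μ (t, s) 2 + μ (t, s) 0 = 1 := by
    intro t ht s hs
    have := (hfeas t ht s hs).2
    rw [Fin.sum_univ_three] at this
    linarith
  obtain ⟨c, hc₁, hc₂⟩ : ∃ c, (∀ t ∈ T₁, interim1 T₂ f u₁ μ t t - t = c) ∧
      ∀ s ∈ T₂, interim2 T₁ f u₂ μ s s - s = c := by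
    obtain ⟨t₀, ht₀⟩ := hT₁
    obtain ⟨s₀, hs₀⟩ := hT₂
    exact ⟨interim1 T₂ f u₁ μ t₀ t₀ - t₀,
      fun t ht => (hegal t ht s₀ hs₀).trans (hegal t₀ ht₀ s₀ hs₀).symm,
      fun s hs => (hegal t₀ ht₀ s hs).symm⟩
  have hc : c = 0 := by
    rcases le_max_iff.1 hcard with h | h
    · refine gain_eq_zero_of_two_types T₁ T₂ h (marg2 T₁ f) hm₂ hq1 (fun t s => μ (t, s) 1)
        (fun t s => μ (t, s) 0) (hnn 1)
        (fun t ht s hs => by linarith [hsum t ht s hs, hnn 2 t ht s hs]) ?_ c ?_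
      · intro t ht r hr
        rw [← i₁ t ht, ← i₁ t ht]
        exact hIC₁ t ht r hr
      · intro t ht
        rw [← i₁ t ht]
        exact hc₁ t ht
    · refine gain_eq_zero_of_two_types T₂ T₁ h (marg1 T₂ f) hm₁ hp1 (fun s t => μ (t, s) 2)
        (fun s t => μ (t, s) 0) (fun s hs t ht => hnn 2 t ht s hs)
        (fun s hs t ht => by linarith [hsum t ht s hs, hnn 1 t ht s hs]) ?_ c ?_
      · intro s hs r hr
        rw [← i₂ s hs, ← i₂ s hs]
        exact hIC₂ s hs r hr
      · intro s hs
        rw [← i₂ s hs]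
        exact hc₂ s hs
  subst hc
  refine disagreement_of_zero_gains T₁ T₂ (marg1 T₂ f) (marg2 T₁ f) hm₁ hm₂ hp1 hq1
    (fun t s => μ (t, s) 1) (fun t s => μ (t, s) 2) (fun t s => μ (t, s) 0) (hnn 1) (hnn 2)
    hsum hdis ?_ ?_
  · intro t ht
    rw [← i₁ t ht]
    exact hc₁ t ht
  · intro s hs
    rw [← i₂ s hs]
    exact hc₂ s hs
end
end

section
/- In the quasi-linear bargaining problem with unbounded transfers, assume f has full support, |T_2| ≥ 2, and S > t_1 + t_2 for all (t_1,t_2) ∈ T where S = max_{k ∈ {1,…,n}} (v_1^k + v_2^k). Then full surplus extraction by player 1 is impossible: there is no incentive compatible, individually rational and efficient mechanism μ with U_2^μ(t_2) = t_2 for all t_2 ∈ T_2. -/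
open Finset

noncomputable section

/-- Physical feasibility of the allocation part `p` of a quasi-linear mechanism. -/
def FeasibleAlloc (T₁ T₂ : Finset ℝ) {n : ℕ} (p : ℝ × ℝ → Fin (n + 1) → ℝ) : Prop :=
  ∀ t₁ ∈ T₁, ∀ t₂ ∈ T₂, (∀ k, 0 ≤ p (t₁, t₂) k) ∧ (∑ k, p (t₁, t₂) k) = 1

/-- Ex-post quasi-linear utility of player 1: the allocation part `p` (index `0` being
disagreement, worth `t₁` to player 1) plus the monetary transfer `m` to player 1. -/
def q1post {n : ℕ} (v₁ : Fin n → ℝ) (p : ℝ × ℝ → Fin (n + 1) → ℝ) (m : ℝ × ℝ → ℝ)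
    (that t : ℝ × ℝ) : ℝ :=
  (∑ k : Fin n, p that k.succ * v₁ k) + p that 0 * t.1 + m that

/-- Ex-post quasi-linear utility of player 2 (who pays the transfer `m`). -/
def q2post {n : ℕ} (v₂ : Fin n → ℝ) (p : ℝ × ℝ → Fin (n + 1) → ℝ) (m : ℝ × ℝ → ℝ)
    (that t : ℝ × ℝ) : ℝ :=
  (∑ k : Fin n, p that k.succ * v₂ k) + p that 0 * t.2 - m that

/-- Interim expected utility of player 1 of true type `t₁` reporting `r₁`. -/
def qInterim1 (T₂ : Finset ℝ) (f : ℝ × ℝ → ℝ) {n : ℕ} (v₁ : Fin n → ℝ)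
    (p : ℝ × ℝ → Fin (n + 1) → ℝ) (m : ℝ × ℝ → ℝ) (r₁ t₁ : ℝ) : ℝ :=
  ∑ t₂ ∈ T₂, f (t₁, t₂) / marg1 T₂ f t₁ * q1post v₁ p m (r₁, t₂) (t₁, t₂)

/-- Interim expected utility of player 2 of true type `t₂` reporting `r₂`. -/
def qInterim2 (T₁ : Finset ℝ) (f : ℝ × ℝ → ℝ) {n : ℕ} (v₂ : Fin n → ℝ)
    (p : ℝ × ℝ → Fin (n + 1) → ℝ) (m : ℝ × ℝ → ℝ) (r₂ t₂ : ℝ) : ℝ :=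
  ∑ t₁ ∈ T₁, f (t₁, t₂) / marg2 T₁ f t₂ * q2post v₂ p m (t₁, r₂) (t₁, t₂)

/-- Replacing the second report by an independent draw from the marginal turns the expectation of
`g` under the joint distribution into its expectation under the product of the marginals. -/
lemma expect_sub_expect_prod_marginals {α β : Type*} (I : Finset α) (J : Finset β)
    (F g : α → β → ℝ) (hF : ∑ i ∈ I, ∑ j ∈ J, F i j = 1) :
    ∑ r ∈ J, ∑ j ∈ J, (∑ i ∈ I, F i r) * (∑ i ∈ I, F i j * g i j - ∑ i ∈ I, F i j * g i r) =
      ∑ i ∈ I, ∑ j ∈ J, F i j * g i j -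
        ∑ i ∈ I, ∑ j ∈ J, (∑ s ∈ J, F i s) * (∑ s ∈ I, F s j) * g i j := by
  have h₁ : ∑ r ∈ J, ∑ j ∈ J, (∑ i ∈ I, F i r) * ∑ i ∈ I, F i j * g i j =
      ∑ i ∈ I, ∑ j ∈ J, F i j * g i j := by
    rw [← Finset.sum_mul_sum, Finset.sum_comm, hF, one_mul, Finset.sum_comm]
  have h₂ : ∑ r ∈ J, ∑ j ∈ J, (∑ i ∈ I, F i r) * ∑ i ∈ I, F i j * g i r =
      ∑ i ∈ I, ∑ j ∈ J, (∑ s ∈ J, F i s) * (∑ s ∈ I, F s j) * g i j := by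
    rw [Finset.sum_comm (s := I)]
    refine Finset.sum_congr rfl fun r _ => ?_
    rw [← Finset.mul_sum, Finset.sum_comm, Finset.mul_sum]
    refine Finset.sum_congr rfl fun i _ => ?_
    rw [← Finset.sum_mul]
    ring
  simp only [mul_sub, Finset.sum_sub_distrib, h₁, h₂]

/-- If no deviation of the column player from truth-telling is profitable, then the expectation of
her payoff `g` under the product of the marginals is at most that under the joint distribution. -/
lemma expect_prod_marginals_le {α β : Type*} (I : Finset α) (J : Finset β)
    (F g : α → β → ℝ) (hF : ∑ i ∈ I, ∑ j ∈ J, F i j = 1)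
    (hpos : ∀ j ∈ J, 0 < ∑ i ∈ I, F i j)
    (hg : ∀ j ∈ J, ∀ r ∈ J, ∑ i ∈ I, F i j * g i r ≤ ∑ i ∈ I, F i j * g i j) :
    ∑ i ∈ I, ∑ j ∈ J, (∑ s ∈ J, F i s) * (∑ s ∈ I, F s j) * g i j ≤
      ∑ i ∈ I, ∑ j ∈ J, F i j * g i j := by
  rw [← sub_nonneg, ← expect_sub_expect_prod_marginals I J F g hF]
  exact Finset.sum_nonneg fun r hr => Finset.sum_nonneg fun j hj =>
    mul_nonneg (hpos r hr).le (sub_nonneg.2 (hg j hj r hr))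

/-- In `expect_prod_marginals_le`, equality forces the column player to be indifferent among all
reports. -/
lemma deviation_eq_of_expect_le {α β : Type*} (I : Finset α) (J : Finset β)
    (F g : α → β → ℝ) (hF : ∑ i ∈ I, ∑ j ∈ J, F i j = 1)
    (hpos : ∀ j ∈ J, 0 < ∑ i ∈ I, F i j)
    (hg : ∀ j ∈ J, ∀ r ∈ J, ∑ i ∈ I, F i j * g i r ≤ ∑ i ∈ I, F i j * g i j)
    (hle : ∑ i ∈ I, ∑ j ∈ J, F i j * g i j ≤
      ∑ i ∈ I, ∑ j ∈ J, (∑ s ∈ J, F i s) * (∑ s ∈ I, F s j) * g i j) :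
    ∀ j ∈ J, ∀ r ∈ J, ∑ i ∈ I, F i j * g i r = ∑ i ∈ I, F i j * g i j := by
  intro j hj r hr
  have hnn : ∀ r ∈ J, ∀ j ∈ J,
      0 ≤ (∑ i ∈ I, F i r) * (∑ i ∈ I, F i j * g i j - ∑ i ∈ I, F i j * g i r) :=
    fun r hr j hj => mul_nonneg (hpos r hr).le (sub_nonneg.2 (hg j hj r hr))
  have h0 := le_antisymm ((expect_sub_expect_prod_marginals I J F g hF).trans_le
    (sub_nonpos.2 hle)) (Finset.sum_nonneg fun r hr => Finset.sum_nonneg (hnn r hr))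
  rw [Finset.sum_eq_zero_iff_of_nonneg fun r hr => Finset.sum_nonneg (hnn r hr)] at h0
  have h1 := (Finset.sum_eq_zero_iff_of_nonneg (hnn r hr)).1 (h0 r hr) j hj
  rcases mul_eq_zero.1 h1 with h | h
  · exact absurd h (hpos r hr).ne'
  · linarith

/-- In a constant-sum direct mechanism in which truth-telling is optimal for both players, the
conditional expectation of the column player's payoff does not depend on her type. -/
lemma truthful_interim_payoff_const {α β : Type*} (I : Finset α) (J : Finset β)
    (F g : α → β → ℝ) (hF : ∑ i ∈ I, ∑ j ∈ J, F i j = 1)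
    (hrow : ∀ i ∈ I, 0 < ∑ j ∈ J, F i j) (hcol : ∀ j ∈ J, 0 < ∑ i ∈ I, F i j)
    (hmin : ∀ i ∈ I, ∀ r ∈ I, ∑ j ∈ J, F i j * g i j ≤ ∑ j ∈ J, F i j * g r j)
    (hmax : ∀ j ∈ J, ∀ r ∈ J, ∑ i ∈ I, F i j * g i r ≤ ∑ i ∈ I, F i j * g i j) :
    ∃ c : ℝ, ∀ j ∈ J, ∑ i ∈ I, F i j * g i j = c * ∑ i ∈ I, F i j := by
  have hF' : ∑ j ∈ J, ∑ i ∈ I, F i j = 1 := by rw [Finset.sum_comm, hF]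
  have hmin' : ∀ i ∈ I, ∀ r ∈ I,
      ∑ j ∈ J, F i j * -g r j ≤ ∑ j ∈ J, F i j * -g i j := by
    intro i hi r hr
    simpa only [mul_neg, Finset.sum_neg_distrib, neg_le_neg_iff] using hmin i hi r hr
  have hcomm : ∑ j ∈ J, ∑ i ∈ I, (∑ s ∈ I, F s j) * (∑ s ∈ J, F i s) * g i j =
      ∑ i ∈ I, ∑ j ∈ J, (∑ s ∈ J, F i s) * (∑ s ∈ I, F s j) * g i j := by
    rw [Finset.sum_comm]
    simp only [mul_comm (∑ s ∈ I, F s _)]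
  have hle := expect_prod_marginals_le I J F g hF hcol hmax
  have hge := expect_prod_marginals_le J I (fun j i => F i j) (fun j i => -g i j) hF' hrow hmin'
  have heq₂ := deviation_eq_of_expect_le I J F g hF hcol hmax (by
    simp only [mul_neg, Finset.sum_neg_distrib, neg_le_neg_iff, hcomm] at hge
    rwa [Finset.sum_comm (s := J)] at hge)
  have heq₁ := deviation_eq_of_expect_le J I (fun j i => F i j) (fun j i => -g i j) hF' hrow hmin'
    (by
      simp only [mul_neg, Finset.sum_neg_distrib, neg_le_neg_iff, hcomm]
      rwa [Finset.sum_comm (s := J)])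
  simp only [mul_neg, Finset.sum_neg_distrib, neg_inj] at heq₁
  obtain rfl | ⟨i, hi⟩ := I.eq_empty_or_nonempty
  · simp at hF
  refine ⟨(∑ s ∈ J, F i s * g i s) / ∑ s ∈ J, F i s, fun j hj => ?_⟩
  rw [div_mul_eq_mul_div, eq_div_iff (hrow i hi).ne']
  calc (∑ r ∈ I, F r j * g r j) * ∑ s ∈ J, F i s
      = ∑ s ∈ J, (∑ r ∈ I, F r j * g r s) * F i s := by
        rw [Finset.mul_sum]
        exact Finset.sum_congr rfl fun s hs => by rw [heq₂ j hj s hs]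
    _ = ∑ r ∈ I, F r j * ∑ s ∈ J, F i s * g r s := by
        simp only [Finset.sum_mul, Finset.mul_sum]
        rw [Finset.sum_comm]
        exact Finset.sum_congr rfl fun r _ => Finset.sum_congr rfl fun s _ => by ring
    _ = (∑ s ∈ J, F i s * g i s) * ∑ r ∈ I, F r j := by
        rw [Finset.mul_sum]
        exact Finset.sum_congr rfl fun r hr => by rw [heq₁ i hi r hr, mul_comm]

/-- An efficient lottery puts no weight on a disagreement outcome that is worse than the best
agreement. -/
lemma disagreement_prob_eq_zero {n : ℕ} {v₁ v₂ : Fin n → ℝ} {S : ℝ}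
    (hS : ∀ k, v₁ k + v₂ k ≤ S) {p : ℝ × ℝ → Fin (n + 1) → ℝ} {m : ℝ × ℝ → ℝ} {t : ℝ × ℝ}
    (hp : ∀ k, 0 ≤ p t k) (hp1 : ∑ k, p t k = 1) (ht : t.1 + t.2 < S)
    (heff : q1post v₁ p m t t + q2post v₂ p m t t = S) : p t 0 = 0 := by
  rw [Fin.sum_univ_succ] at hp1
  have hle : ∑ k : Fin n, p t k.succ * (v₁ k + v₂ k) ≤ (∑ k : Fin n, p t k.succ) * S := by
    rw [Finset.sum_mul]
    exact Finset.sum_le_sum fun k _ => mul_le_mul_of_nonneg_left (hS k) (hp _)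
  simp only [mul_add, Finset.sum_add_distrib] at hle
  unfold q1post q2post at heff
  have hsum : ∑ k : Fin n, p t k.succ = 1 - p t 0 := by linarith
  rw [hsum] at hle
  have h0 : p t 0 * (S - (t.1 + t.2)) ≤ 0 := by linarith
  exact le_antisymm (nonpos_of_mul_nonpos_left h0 (sub_pos.2 ht)) (hp 0)

/-- **Corollary 5.**  In the quasi-linear bargaining problem with unbounded transfers, two-sided
incomplete information (`|T₂| ≥ 2`) and a full-support prior, player 1 cannot extract all
surplus: there is no incentive compatible, individually rational, efficient mechanism that gives
every type of player 2 exactly her disagreement payoff. -/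
theorem no_full_surplus_extraction (n : ℕ) (hn : 0 < n)
    (T₁ T₂ : Finset ℝ) (hT₁ : T₁.Nonempty) (hT₂ : T₂.Nonempty)
    (hcard : 2 ≤ T₂.card)
    (v₁ v₂ : Fin n → ℝ) (S : ℝ)
    (hS : (∀ k : Fin n, v₁ k + v₂ k ≤ S) ∧ (∃ k : Fin n, v₁ k + v₂ k = S))
    (hdis : ∀ t₁ ∈ T₁, ∀ t₂ ∈ T₂, t₁ + t₂ < S)
    (f : ℝ × ℝ → ℝ) (hf : IsPrior T₁ T₂ f)
    (hfull : ∀ t₁ ∈ T₁, ∀ t₂ ∈ T₂, 0 < f (t₁, t₂)) :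
    ¬ ∃ (p : ℝ × ℝ → Fin (n + 1) → ℝ) (m : ℝ × ℝ → ℝ),
      FeasibleAlloc T₁ T₂ p ∧
      (∀ t₁ ∈ T₁, ∀ r₁ ∈ T₁, qInterim1 T₂ f v₁ p m r₁ t₁ ≤ qInterim1 T₂ f v₁ p m t₁ t₁) ∧
      (∀ t₂ ∈ T₂, ∀ r₂ ∈ T₂, qInterim2 T₁ f v₂ p m r₂ t₂ ≤ qInterim2 T₁ f v₂ p m t₂ t₂) ∧
      (∀ t₁ ∈ T₁, t₁ ≤ qInterim1 T₂ f v₁ p m t₁ t₁) ∧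
      (∀ t₂ ∈ T₂, t₂ ≤ qInterim2 T₁ f v₂ p m t₂ t₂) ∧
      (∀ t₁ ∈ T₁, ∀ t₂ ∈ T₂, 0 < f (t₁, t₂) →
        q1post v₁ p m (t₁, t₂) (t₁, t₂) + q2post v₂ p m (t₁, t₂) (t₁, t₂) = S) ∧
      (∀ t₂ ∈ T₂, qInterim2 T₁ f v₂ p m t₂ t₂ = t₂) := by
  rintro ⟨p, m, hp, hIC₁, hIC₂, -, -, heff, hext⟩
  obtain ⟨-, hsum, hm₁, hm₂⟩ := hf
  have hp0 : ∀ t₁ ∈ T₁, ∀ t₂ ∈ T₂, p (t₁, t₂) 0 = 0 := fun t₁ h₁ t₂ h₂ =>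
    disagreement_prob_eq_zero hS.1 (hp t₁ h₁ t₂ h₂).1 (hp t₁ h₁ t₂ h₂).2 (hdis t₁ h₁ t₂ h₂)
      (heff t₁ h₁ t₂ h₂ (hfull t₁ h₁ t₂ h₂))
  set g : ℝ → ℝ → ℝ := fun s₁ s₂ => q2post v₂ p m (s₁, s₂) (s₁, s₂) with hgdef
  have hu₂ : ∀ s₁ ∈ T₁, ∀ s₂ ∈ T₂, ∀ t, q2post v₂ p m (s₁, s₂) t = g s₁ s₂ := by
    intro s₁ h₁ s₂ h₂ t
    simp [hgdef, q2post, hp0 s₁ h₁ s₂ h₂]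
  have hu₁ : ∀ s₁ ∈ T₁, ∀ s₂ ∈ T₂, ∀ t, q1post v₁ p m (s₁, s₂) t = S - g s₁ s₂ := by
    intro s₁ h₁ s₂ h₂ t
    rw [← heff s₁ h₁ s₂ h₂ (hfull s₁ h₁ s₂ h₂)]
    simp [hgdef, q1post, hp0 s₁ h₁ s₂ h₂]
  have hU₂ : ∀ r ∈ T₂, ∀ t ∈ T₂,
      qInterim2 T₁ f v₂ p m r t = (∑ i ∈ T₁, f (i, t) * g i r) / marg2 T₁ f t := by
    intro r hr t _
    rw [qInterim2, Finset.sum_div]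
    exact Finset.sum_congr rfl fun i hi => by rw [hu₂ i hi r hr]; ring
  have hU₁ : ∀ r ∈ T₁, ∀ t ∈ T₁,
      qInterim1 T₂ f v₁ p m r t = S - (∑ j ∈ T₂, f (t, j) * g r j) / marg1 T₂ f t := by
    intro r hr t ht
    have hS1 : S = ∑ j ∈ T₂, f (t, j) / marg1 T₂ f t * S := by
      rw [← Finset.sum_mul, ← Finset.sum_div]
      change S = marg1 T₂ f t / marg1 T₂ f t * S
      rw [div_self (hm₁ t ht).ne', one_mul]
    rw [qInterim1, Finset.sum_div]
    conv_rhs => rw [hS1]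
    rw [← Finset.sum_sub_distrib]
    exact Finset.sum_congr rfl fun j hj => by rw [hu₁ r hr j hj]; ring
  obtain ⟨c, hc⟩ := truthful_interim_payoff_const T₁ T₂ (fun i j => f (i, j)) g hsum hm₁ hm₂
    (fun t ht r hr => by
      have h := hIC₁ t ht r hr
      rwa [hU₁ r hr t ht, hU₁ t ht t ht, sub_le_sub_iff_left,
        div_le_div_iff_of_pos_right (hm₁ t ht)] at h)
    (fun t ht r hr => by
      have h := hIC₂ t ht r hr
      rwa [hU₂ r hr t ht, hU₂ t ht t ht, div_le_div_iff_of_pos_right (hm₂ t ht)] at h)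
  have htype : ∀ t ∈ T₂, t = c := fun t ht => by
    rw [← hext t ht, hU₂ t ht t ht, div_eq_iff (hm₂ t ht).ne']
    exact hc t ht
  obtain ⟨a, ha, b, hb, hab⟩ := Finset.one_lt_card.1 hcard
  exact hab ((htype a ha).trans (htype b hb).symm)
end
end

section
/- Suppose f is independent (f(t_1,t_2) = f_1(t_1) f_2(t_2)) and let ε ≥ 0. If μ is an incentive compatible mechanism that is ε-efficient, i.e., μ^0(t) ≤ ε for every t ∈ T with f(t) > 0, then μ is ε-cardinal: |U_i^μ(t_i) − U_i^μ(t_i')| ≤ ε |t_i − t_i'| for every player i and all t_i, t_i' ∈ T_i. -/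
open Finset

noncomputable section

/-- If truthful reporting is optimal for a family of payoffs that is affine in the true type with
slopes `q r ∈ [0, ε]`, then the truthful payoff is `ε`-Lipschitz in the type. -/
theorem abs_sub_le_of_affine_of_truthful {S : Finset ℝ} {ε : ℝ} {U : ℝ → ℝ → ℝ} {a q : ℝ → ℝ}
    (hU : ∀ r ∈ S, ∀ t ∈ S, U r t = a r + q r * t)
    (hq₀ : ∀ r ∈ S, 0 ≤ q r) (hq : ∀ r ∈ S, q r ≤ ε)
    (hIC : ∀ t ∈ S, ∀ r ∈ S, U r t ≤ U t t) :
    ∀ t ∈ S, ∀ s ∈ S, |U t t - U s s| ≤ ε * |t - s| := by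
  have key : ∀ t ∈ S, ∀ s ∈ S, U t t - U s s ≤ ε * |t - s| := fun t ht s hs => calc
    U t t - U s s ≤ U t t - U t s := sub_le_sub_left (hIC s hs t ht) _
    _ = q t * (t - s) := by rw [hU t ht t ht, hU t ht s hs]; ring
    _ ≤ q t * |t - s| := mul_le_mul_of_nonneg_left (le_abs_self _) (hq₀ t ht)
    _ ≤ ε * |t - s| := mul_le_mul_of_nonneg_right (hq t ht) (abs_nonneg _)
  intro t ht s hs
  refine abs_sub_le_iff.2 ⟨key t ht s hs, ?_⟩
  rw [abs_sub_comm]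
  exact key s hs t ht

/-- A weighted average of numbers that are at most `c` is at most `c`. -/
theorem sum_mul_le_of_sum_eq_one {ι : Type*} {S : Finset ι} {w x : ι → ℝ} {c : ℝ}
    (hw : ∀ i ∈ S, 0 ≤ w i) (hw₁ : ∑ i ∈ S, w i = 1) (hx : ∀ i ∈ S, x i ≤ c) :
    ∑ i ∈ S, w i * x i ≤ c := calc
  ∑ i ∈ S, w i * x i ≤ ∑ i ∈ S, w i * c :=
    Finset.sum_le_sum fun i hi => mul_le_mul_of_nonneg_left (hx i hi) (hw i hi)
  _ = c := by rw [← Finset.sum_mul, hw₁, one_mul]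

/-- **Remark 4.**  With independent prior beliefs, an incentive compatible `ε`-efficient
mechanism (disagreement probability at most `ε` at every state in the support) is
`ε`-cardinal: interim utilities of any two types of a player differ by at most `ε` times the
distance between the types. -/
theorem epsEfficient_implies_epsCardinal (n : ℕ) (hn : 2 ≤ n)
    (T₁ T₂ : Finset ℝ) (hT₁ : T₁.Nonempty) (hT₂ : T₂.Nonempty)
    (u₁ u₂ : Fin n → ℝ)
    (hnorm : u₁ ⟨0, by omega⟩ = 1 ∧ u₂ ⟨0, by omega⟩ = 0 ∧
      u₁ ⟨1, by omega⟩ = 0 ∧ u₂ ⟨1, by omega⟩ = 1)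
    (f : ℝ × ℝ → ℝ) (hf : IsPrior T₁ T₂ f)
    (hind : ∀ t₁ ∈ T₁, ∀ t₂ ∈ T₂, f (t₁, t₂) = marg1 T₂ f t₁ * marg2 T₁ f t₂)
    (ε : ℝ) (hε : 0 ≤ ε)
    (μ : ℝ × ℝ → Fin (n + 1) → ℝ)
    (hfeas : Feasible T₁ T₂ μ) (hIC : IC T₁ T₂ f u₁ u₂ μ)
    (heff : ∀ t₁ ∈ T₁, ∀ t₂ ∈ T₂, 0 < f (t₁, t₂) → μ (t₁, t₂) 0 ≤ ε) :
    (∀ t₁ ∈ T₁, ∀ s₁ ∈ T₁,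
      |interim1 T₂ f u₁ μ t₁ t₁ - interim1 T₂ f u₁ μ s₁ s₁| ≤ ε * |t₁ - s₁|) ∧
    (∀ t₂ ∈ T₂, ∀ s₂ ∈ T₂,
      |interim2 T₁ f u₂ μ t₂ t₂ - interim2 T₁ f u₂ μ s₂ s₂| ≤ ε * |t₂ - s₂|) := by
  obtain ⟨-, hsum, hm₁, hm₂⟩ := hf
  have hs₁ : ∑ x ∈ T₁, marg1 T₂ f x = 1 := hsum
  have hs₂ : ∑ x ∈ T₂, marg2 T₁ f x = 1 := by
    unfold marg2
    rw [Finset.sum_comm, hsum]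
  have hpos : ∀ t₁ ∈ T₁, ∀ t₂ ∈ T₂, 0 < f (t₁, t₂) := fun t₁ h₁ t₂ h₂ => by
    rw [hind t₁ h₁ t₂ h₂]
    exact mul_pos (hm₁ t₁ h₁) (hm₂ t₂ h₂)
  constructor
  · refine abs_sub_le_of_affine_of_truthful
      (a := fun r => ∑ x ∈ T₂, marg2 T₁ f x * ∑ k : Fin n, μ (r, x) k.succ * u₁ k)
      (q := fun r => ∑ x ∈ T₂, marg2 T₁ f x * μ (r, x) 0) ?_ ?_ ?_ hIC.1
    · intro r _ t ht
      simp only [interim1, u1post, Finset.sum_mul, ← Finset.sum_add_distrib]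
      refine Finset.sum_congr rfl fun x hx => ?_
      rw [hind t ht x hx, mul_div_cancel_left₀ _ (hm₁ t ht).ne']
      ring
    · exact fun r hr => Finset.sum_nonneg fun x hx =>
        mul_nonneg (hm₂ x hx).le ((hfeas r hr x hx).1 0)
    · exact fun r hr => sum_mul_le_of_sum_eq_one (fun x hx => (hm₂ x hx).le) hs₂
        fun x hx => heff r hr x hx (hpos r hr x hx)
  · refine abs_sub_le_of_affine_of_truthful
      (a := fun r => ∑ x ∈ T₁, marg1 T₂ f x * ∑ k : Fin n, μ (x, r) k.succ * u₂ k)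
      (q := fun r => ∑ x ∈ T₁, marg1 T₂ f x * μ (x, r) 0) ?_ ?_ ?_ hIC.2
    · intro r _ t ht
      simp only [interim2, u2post, Finset.sum_mul, ← Finset.sum_add_distrib]
      refine Finset.sum_congr rfl fun x hx => ?_
      rw [hind x hx t ht, mul_div_cancel_right₀ _ (hm₂ t ht).ne']
      ring
    · exact fun r hr => Finset.sum_nonneg fun x hx =>
        mul_nonneg (hm₁ x hx).le ((hfeas x hx r hr).1 0)
    · exact fun r hr => sum_mul_le_of_sum_eq_one (fun x hx => (hm₁ x hx).le) hs₁
        fun x hx => heff x hx r hr (hpos x hx r hr)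
end
end

section
/- Consider the three-player problem with A = {a_0, a_1, a_2, a_3}, player i's utility 1 at a_i and 0 at a_j for j ≠ i (j ∈ {1,2,3}); each player has two types with disagreement values d(1) = 0 and d(2) = u² ∈ (0, 1/3); for ε ∈ (0, 1/12] the symmetric prior f on {1,2}³ has f(1,1,1) = 1/2 − 4ε, f(2,2,2) = 1/2 − 5ε, f = ε at each permutation of (2,1,1), and f = 2ε at each permutation of (2,2,1). Let μ be the mechanism: if all three reports agree, select each of a_1, a_2, a_3 with probability 1/3; if exactly players i and j report the same type, select a_i and a_j each with probability 1/2; never select a_0. Then for every such ε and u², μ is incentive compatible, individually rational, efficient (the three agreement payoffs always sum to 1, the maximum possible), and cardinal: each player's interim utility equals 1/3 − (2/3)ε at type 1 and 1/3 + (2/3)ε at type 2, which differ. Hence with three players and correlated types, an efficient cardinal mechanism can exist. -/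
open Finset

noncomputable section

/-- Disagreement utilities of the two types (`0` for type 1, `q = u² ∈ (0, 1/3)` for type 2). -/
def d18 (q : ℝ) : Fin 2 → ℝ := ![0, q]

/-- Number of players reporting type 2 in a profile. -/
def cnt (t : Fin 3 → Fin 2) : ℕ := (Finset.univ.filter fun i => t i = 1).card

/-- The symmetric correlated prior on `{1,2}³` (parameter `ε ∈ (0, 1/12]`). -/
def prior18 (ε : ℝ) (t : Fin 3 → Fin 2) : ℝ :=
  if cnt t = 0 then 1/2 - 4 * ε
  else if cnt t = 1 then ε
  else if cnt t = 2 then 2 * ε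
  else 1/2 - 5 * ε

/-- The type reported by a (weak) majority of the three players. -/
def maj18 (t : Fin 3 → Fin 2) : Fin 2 :=
  if 2 ≤ (Finset.univ.filter fun i => t i = 0).card then 0 else 1

/-- The mechanism: if all reports agree, randomize uniformly over `a₁, a₂, a₃`; otherwise the
two players in the majority get their favourite alternative with probability `1/2` each;
`a₀` (index `0`) is never selected. -/
def mech18 (t : Fin 3 → Fin 2) : Fin 4 → ℝ :=
  Fin.cons 0 fun i : Fin 3 =>
    if ∀ a b : Fin 3, t a = t b then 1/3
    else if t i = maj18 t then 1/2 else 0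

/-- Ex-post utility of player `i` of true type `τ` at report profile `that`. -/
def xp18 (q : ℝ) (i : Fin 3) (that : Fin 3 → Fin 2) (τ : Fin 2) : ℝ :=
  (∑ k : Fin 3, mech18 that k.succ * (if k = i then (1 : ℝ) else 0)) +
    mech18 that 0 * d18 q τ

/-- Marginal probability that player `i` is of type `τ`. -/
def marg18 (ε : ℝ) (i : Fin 3) (τ : Fin 2) : ℝ :=
  ∑ s : Fin 3 → Fin 2, if s i = τ then prior18 ε s else 0

/-- Interim expected utility of player `i` of true type `τ` reporting `r`, the others
reporting truthfully. -/
def U18 (ε q : ℝ) (i : Fin 3) (r τ : Fin 2) : ℝ :=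
  ∑ s : Fin 3 → Fin 2, (if s i = τ then prior18 ε s / marg18 ε i τ else 0) *
    xp18 q i (Function.update s i r) τ

theorem sum_fin_three_fun_fin_two (F : (Fin 3 → Fin 2) → ℝ) :
    ∑ s, F s = F ![0, 0, 0] + F ![1, 0, 0] + F ![0, 1, 0] + F ![0, 0, 1] +
      F ![1, 1, 0] + F ![1, 0, 1] + F ![0, 1, 1] + F ![1, 1, 1] := by
  have h : (Finset.univ : Finset (Fin 3 → Fin 2)) =
      {![0, 0, 0], ![1, 0, 0], ![0, 1, 0], ![0, 0, 1],
        ![1, 1, 0], ![1, 0, 1], ![0, 1, 1], ![1, 1, 1]} := by decide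
  rw [h]
  repeat rw [Finset.sum_insert (by decide)]
  rw [Finset.sum_singleton]
  ring

theorem prior18_values (ε : ℝ) :
    prior18 ε ![0, 0, 0] = 1/2 - 4 * ε ∧ prior18 ε ![1, 0, 0] = ε ∧
    prior18 ε ![0, 1, 0] = ε ∧ prior18 ε ![0, 0, 1] = ε ∧
    prior18 ε ![1, 1, 0] = 2 * ε ∧ prior18 ε ![1, 0, 1] = 2 * ε ∧
    prior18 ε ![0, 1, 1] = 2 * ε ∧ prior18 ε ![1, 1, 1] = 1/2 - 5 * ε := by
  have h0 : cnt ![0, 0, 0] = 0 := by decide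
  have h1 : cnt ![1, 0, 0] = 1 := by decide
  have h2 : cnt ![0, 1, 0] = 1 := by decide
  have h3 : cnt ![0, 0, 1] = 1 := by decide
  have h4 : cnt ![1, 1, 0] = 2 := by decide
  have h5 : cnt ![1, 0, 1] = 2 := by decide
  have h6 : cnt ![0, 1, 1] = 2 := by decide
  have h7 : cnt ![1, 1, 1] = 3 := by decide
  simp [prior18, h0, h1, h2, h3, h4, h5, h6, h7]

theorem marg18_eq_half (ε : ℝ) (i : Fin 3) (τ : Fin 2) : marg18 ε i τ = 1/2 := by
  obtain ⟨h0, h1, h2, h3, h4, h5, h6, h7⟩ := prior18_values ε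
  rw [marg18, sum_fin_three_fun_fin_two, h0, h1, h2, h3, h4, h5, h6, h7]
  fin_cases i <;> fin_cases τ <;> simp <;> ring

theorem xp18_eq_mech18 (q : ℝ) (i : Fin 3) (t : Fin 3 → Fin 2) (τ : Fin 2) :
    xp18 q i t τ = mech18 t i.succ := by
  simp [xp18, mech18]

/-- The probability of a player's favourite alternative, in terms of whether she agrees with
each of the other two reports. -/
theorem mech18_succ (t : Fin 3 → Fin 2) (i : Fin 3) :
    mech18 t i.succ =
      if t i = t (i + 1) ∧ t i = t (i + 2) then 1/3
      else if t i = t (i + 1) ∨ t i = t (i + 2) then 1/2 else 0 := by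
  have h : ∀ t : Fin 3 → Fin 2, ∀ i : Fin 3,
      ((∀ a b : Fin 3, t a = t b) ↔ (t i = t (i + 1) ∧ t i = t (i + 2))) ∧
      (¬ (∀ a b : Fin 3, t a = t b) →
        (t i = maj18 t ↔ (t i = t (i + 1) ∨ t i = t (i + 2)))) := by
    decide
  obtain ⟨ha, hm⟩ := h t i
  simp only [mech18, Fin.cons_succ]
  by_cases hu : ∀ a b : Fin 3, t a = t b
  · rw [if_pos hu, if_pos (ha.1 hu)]
  · rw [if_neg hu, if_neg (fun h' => hu (ha.2 h'))]
    simp only [hm hu]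

theorem U18_values (ε q : ℝ) (i : Fin 3) :
    U18 ε q i 0 0 = 1/3 - 2/3 * ε ∧ U18 ε q i 1 1 = 1/3 + 2/3 * ε ∧
    U18 ε q i 1 0 = 10/3 * ε ∧ U18 ε q i 0 1 = 14/3 * ε := by
  obtain ⟨h0, h1, h2, h3, h4, h5, h6, h7⟩ := prior18_values ε
  simp only [U18, marg18_eq_half, xp18_eq_mech18, mech18_succ, sum_fin_three_fun_fin_two,
    h0, h1, h2, h3, h4, h5, h6, h7]
  fin_cases i <;> refine ⟨?_, ?_, ?_, ?_⟩ <;>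
    simp [Fin.ext_iff] <;> ring

theorem sum_mech18_succ (t : Fin 3 → Fin 2) : ∑ k : Fin 3, mech18 t k.succ = 1 := by
  have two : ∀ x : Fin 2, x = 0 ∨ x = 1 := by decide
  simp only [mech18_succ, Fin.sum_univ_three]
  rcases two (t 0) with h0 | h0 <;> rcases two (t 1) with h1 | h1 <;>
    rcases two (t 2) with h2 | h2 <;> simp [h0, h1, h2] <;> norm_num

/-- **Remark 3, three-player example.**  With three players and correlated types, the mechanism
`mech18` is incentive compatible, individually rational, efficient (it always splits the full
surplus `1`), and cardinal: each player's interim utility is `1/3 - (2/3)ε` at type 1 and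
`1/3 + (2/3)ε` at type 2. -/
theorem three_player_efficient_cardinal (ε q : ℝ)
    (hε : 0 < ε) (hε' : ε ≤ 1/12) (hq : 0 < q) (hq' : q < 1/3) :
    (∀ i : Fin 3, ∀ τ r : Fin 2, U18 ε q i r τ ≤ U18 ε q i τ τ) ∧
    (∀ i : Fin 3, ∀ τ : Fin 2, d18 q τ ≤ U18 ε q i τ τ) ∧
    (∀ t : Fin 3 → Fin 2, mech18 t 0 = 0 ∧ (∑ k : Fin 3, mech18 t k.succ) = 1) ∧
    (∀ i : Fin 3, U18 ε q i 0 0 = 1/3 - 2/3 * ε ∧ U18 ε q i 1 1 = 1/3 + 2/3 * ε ∧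
      U18 ε q i 0 0 ≠ U18 ε q i 1 1) := by
  refine ⟨fun i τ r => ?_, fun i τ => ?_, fun t => ⟨rfl, sum_mech18_succ t⟩, fun i => ?_⟩
  · obtain ⟨h00, h11, h10, h01⟩ := U18_values ε q i
    fin_cases τ <;> fin_cases r <;> simp only [Fin.zero_eta, Fin.mk_one] <;> linarith
  · obtain ⟨h00, h11, -, -⟩ := U18_values ε q i
    fin_cases τ <;> simp [d18, h00, h11] <;> linarith
  · obtain ⟨h00, h11, -, -⟩ := U18_values ε q i
    exact ⟨h00, h11, by rw [h00, h11]; intro h; linarith⟩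
end
end
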